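/- arXiv:0904.1710 — 5 statements merged into one kernel-verified Lean document; each statement's English description precedes it below -/
import Mathlib

section
/- Let p = 2 ≤ q. For every positive semidefinite Y ∈ M_n ⊗ M_m, ‖Y‖_{CL} ≥ (1/√2) · Ψ_{2,q}(Y). -/
open scoped Kronecker
open Matrix
open scoped ENNReal NNReal ComplexOrder

noncomputable section

open scoped Classical in
/-- The Schatten `p`-norm of a complex square matrix, `p ∈ [1,∞]` (as an `ℝ≥0∞`).
For finite `p` it equals `(Tr |A|^p)^{1/p}`, computed via the eigenvalues of `Aᴴ * A`;
for `p = ∞` it is the operator norm (largest singular value). -/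
noncomputable def schattenNorm {k : Type*} [Fintype k] [DecidableEq k] (p : ℝ≥0∞)
    (A : Matrix k k ℂ) : ℝ :=
  if p = ⊤ then
    ⨆ i, Real.sqrt ((Matrix.posSemidef_conjTranspose_mul_self A).isHermitian.eigenvalues i)
  else
    (∑ i, (Matrix.posSemidef_conjTranspose_mul_self A).isHermitian.eigenvalues i
        ^ (p.toReal / 2)) ^ (1 / p.toReal)

/-- `r` defined by `1/r = max{1/p, 1/q} - min{1/p, 1/q}` (so `r = ∞` when `p = q`). -/
noncomputable def ncR (p q : ℝ≥0∞) : ℝ≥0∞ := (max p⁻¹ q⁻¹ - min p⁻¹ q⁻¹)⁻¹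

/-- The non-commutative `L^q(L^p)` norm (supremum form, used when `p ≤ q`):
`sup_{A,B} ‖(A ⊗ I) Y (B ⊗ I)‖_p / (‖A‖_{2r} ‖B‖_{2r})`. -/
noncomputable def ncNormSup {k l : Type*} [Fintype k] [DecidableEq k] [Fintype l] [DecidableEq l]
    (p q : ℝ≥0∞) (Y : Matrix (k × l) (k × l) ℂ) : ℝ :=
  ⨆ A : Matrix k k ℂ, ⨆ B : Matrix k k ℂ,
    schattenNorm p ((A ⊗ₖ (1 : Matrix l l ℂ)) * Y * (B ⊗ₖ (1 : Matrix l l ℂ))) /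
      (schattenNorm (2 * ncR p q) A * schattenNorm (2 * ncR p q) B)

/-- The non-commutative `L^q(L^p)` norm (infimum form, used when `q ≤ p`):
`inf { ∑ᵢ ‖Aᵢ‖_{2r} ‖Bᵢ‖_{2r} ‖Zᵢ‖_p : Y = ∑ᵢ (Aᵢ ⊗ I) Zᵢ (Bᵢ ⊗ I) }`. -/
noncomputable def ncNormInf {k l : Type*} [Fintype k] [DecidableEq k] [Fintype l] [DecidableEq l]
    (p q : ℝ≥0∞) (Y : Matrix (k × l) (k × l) ℂ) : ℝ :=
  sInf { s : ℝ | ∃ (N : ℕ) (A B : Fin N → Matrix k k ℂ)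
      (Z : Fin N → Matrix (k × l) (k × l) ℂ),
    Y = ∑ i, (A i ⊗ₖ (1 : Matrix l l ℂ)) * Z i * (B i ⊗ₖ (1 : Matrix l l ℂ)) ∧
    s = ∑ i, schattenNorm (2 * ncR p q) (A i) * schattenNorm (2 * ncR p q) (B i) *
          schattenNorm p (Z i) }

open scoped Classical in
/-- The non-commutative `L^q(L^p)` norm `‖·‖_{NC:p,q}`. -/
noncomputable def ncNorm {k l : Type*} [Fintype k] [DecidableEq k] [Fintype l] [DecidableEq l]
    (p q : ℝ≥0∞) (Y : Matrix (k × l) (k × l) ℂ) : ℝ :=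
  if p ≤ q then ncNormSup p q Y else ncNormInf p q Y

open scoped Classical in
/-- Real power of a Hermitian matrix via the spectral decomposition (junk value `0` on
non-Hermitian matrices). -/
noncomputable def mrpow {k : Type*} [Fintype k] [DecidableEq k] (A : Matrix k k ℂ) (e : ℝ) :
    Matrix k k ℂ :=
  if hA : A.IsHermitian then
    (hA.eigenvectorUnitary : Matrix k k ℂ) *
      Matrix.diagonal (fun i => ((hA.eigenvalues i ^ e : ℝ) : ℂ)) *
      ((hA.eigenvectorUnitary : Matrix k k ℂ))ᴴ
  else 0

/-- Partial trace over the second (inside) factor. -/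
noncomputable def ptrace2 {k l : Type*} [Fintype l]
    (Y : Matrix (k × l) (k × l) ℂ) : Matrix k k ℂ :=
  fun i i' => ∑ j : l, Y (i, j) (i', j)

/-- The Carlen–Lieb quantity `Ψ_{p,q}(Y) = (Tr₁ (Tr₂ Y^p)^{q/p})^{1/q}`. -/
noncomputable def Psi {k l : Type*} [Fintype k] [DecidableEq k] [Fintype l] [DecidableEq l]
    (p q : ℝ) (Y : Matrix (k × l) (k × l) ℂ) : ℝ :=
  (Matrix.trace (mrpow (ptrace2 (mrpow Y p)) (q / p))).re ^ (1 / q)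

/-- The quantity `|||X|||_{p,q} = inf {Ψ_{p,q}(A) + Ψ_{p,q}(B) : X + A = B, A ≥ 0, B ≥ 0}`,
for `X` on the space `M_k ⊗ (M_l ⊗ M_2)`. -/
noncomputable def tripleNorm {k l : Type*} [Fintype k] [DecidableEq k] [Fintype l] [DecidableEq l]
    (p q : ℝ) (X : Matrix (k × (l × Fin 2)) (k × (l × Fin 2)) ℂ) : ℝ :=
  sInf { s : ℝ | ∃ A B : Matrix (k × (l × Fin 2)) (k × (l × Fin 2)) ℂ,
    A.PosSemidef ∧ B.PosSemidef ∧ X + A = B ∧ s = Psi p q A + Psi p q B }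

/-- The block matrix `[[0, Y],[Yᴴ, 0]]`, viewed in `M_k ⊗ (M_l ⊗ M_2)`. -/
noncomputable def clBlock {k l : Type*} (Y : Matrix (k × l) (k × l) ℂ) :
    Matrix (k × (l × Fin 2)) (k × (l × Fin 2)) ℂ :=
  fun x y =>
    if x.2.2 = 0 ∧ y.2.2 = 1 then Y (x.1, x.2.1) (y.1, y.2.1)
    else if x.2.2 = 1 ∧ y.2.2 = 0 then star (Y (y.1, y.2.1) (x.1, x.2.1))
    else 0

/-- The block-diagonal matrix `diag(P, Q) = [[P, 0],[0, Q]]`, viewed in `M_k ⊗ (M_l ⊗ M_2)`. -/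
noncomputable def blockDiag2 {k l : Type*} (P Q : Matrix (k × l) (k × l) ℂ) :
    Matrix (k × (l × Fin 2)) (k × (l × Fin 2)) ℂ :=
  fun x y =>
    if x.2.2 = 0 ∧ y.2.2 = 0 then P (x.1, x.2.1) (y.1, y.2.1)
    else if x.2.2 = 1 ∧ y.2.2 = 1 then Q (x.1, x.2.1) (y.1, y.2.1)
    else 0

/-- The Carlen–Lieb norm `‖Y‖_{CL} = (1/2) ||| [[0,Y],[Yᴴ,0]] |||_{p,q}`. -/
noncomputable def clNorm {k l : Type*} [Fintype k] [DecidableEq k] [Fintype l] [DecidableEq l]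
    (p q : ℝ) (Y : Matrix (k × l) (k × l) ℂ) : ℝ :=
  (1 / 2) * tripleNorm p q (clBlock Y)

end

/-- Contraction of the outside row index of `A` with the conjugate of the `i`-th column of `U`. -/
noncomputable def contractRow {k l : Type*} [Fintype k] [Fintype l]
    (U : Matrix k k ℂ) (i : k) (A : Matrix (k × l) (k × l) ℂ) :
    EuclideanSpace ℂ (l × (k × l)) :=
  WithLp.toLp 2 fun z => ∑ a, star (U a i) * A (a, z.1) z.2

section

variable {k l : Type*} [Fintype k] [DecidableEq k] [Fintype l] [DecidableEq l]

theorem mrpow_two {A : Matrix k k ℂ} (hA : A.IsHermitian) : mrpow A 2 = A * A := by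
  have h := hA.spectral_theorem
  rw [Unitary.conjStarAlgAut_apply] at h
  have hU : star (hA.eigenvectorUnitary : Matrix k k ℂ) * (hA.eigenvectorUnitary : Matrix k k ℂ) = 1 :=
    Unitary.coe_star_mul_self _
  rw [mrpow, dif_pos hA]
  conv_rhs => rw [h]
  set U := (hA.eigenvectorUnitary : Matrix k k ℂ)
  set D := diagonal ((RCLike.ofReal : ℝ → ℂ) ∘ hA.eigenvalues) with hD
  have : U * D * star U * (U * D * star U) = U * (D * D) * star U := by
    calc _ = U * D * (star U * U) * D * star U := by simp only [Matrix.mul_assoc]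
      _ = _ := by rw [hU]; simp only [Matrix.mul_assoc, Matrix.one_mul]
  rw [this, hD, diagonal_mul_diagonal, star_eq_conjTranspose]
  congr 3
  ext i
  simp [sq]

theorem re_trace_mrpow {A : Matrix k k ℂ} (hA : A.IsHermitian) (e : ℝ) :
    (mrpow A e).trace.re = ∑ i, hA.eigenvalues i ^ e := by
  have hU : star (hA.eigenvectorUnitary : Matrix k k ℂ) * (hA.eigenvectorUnitary : Matrix k k ℂ) = 1 :=
    Unitary.coe_star_mul_self _
  rw [star_eq_conjTranspose] at hU
  rw [mrpow, dif_pos hA, trace_mul_comm, ← Matrix.mul_assoc, hU, Matrix.one_mul, trace_diagonal,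
    Complex.re_sum]
  simp

/-- Diagonal entries of a Hermitian matrix in another orthonormal basis. -/
theorem conj_unitary_diag_re {H : Matrix k k ℂ} (hH : H.IsHermitian) (U : Matrix k k ℂ) (i : k) :
    ((Uᴴ * H * U) i i).re =
      ∑ j, ‖(Uᴴ * (hH.eigenvectorUnitary : Matrix k k ℂ)) i j‖ ^ 2 * hH.eigenvalues j := by
  have h := hH.spectral_theorem
  rw [Unitary.conjStarAlgAut_apply] at h
  set V := (hH.eigenvectorUnitary : Matrix k k ℂ)
  set D := diagonal ((RCLike.ofReal : ℝ → ℂ) ∘ hH.eigenvalues) with hD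
  have : Uᴴ * H * U = (Uᴴ * V) * D * (Uᴴ * V)ᴴ := by
    conv_lhs => rw [h]
    rw [conjTranspose_mul, conjTranspose_conjTranspose, star_eq_conjTranspose]
    simp only [Matrix.mul_assoc]
  rw [this, Matrix.mul_apply, Complex.re_sum]
  refine Finset.sum_congr rfl fun j _ => ?_
  rw [hD, mul_diagonal, conjTranspose_apply]
  generalize (Uᴴ * V) i j = w
  rw [mul_right_comm, RCLike.star_def, Complex.mul_conj, Complex.normSq_eq_norm_sq]
  simp [-Complex.ofReal_pow]

theorem sum_norm_sq_row {W : Matrix k k ℂ} (hW : W * Wᴴ = 1) (i : k) :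
    ∑ j, ‖W i j‖ ^ 2 = 1 := by
  have h := congrArg Complex.re (congrFun (congrFun hW i) i)
  rw [Matrix.mul_apply, Complex.re_sum] at h
  simp only [conjTranspose_apply, RCLike.star_def, Complex.mul_conj, Complex.normSq_eq_norm_sq,
    Complex.ofReal_re, one_apply_eq, Complex.one_re] at h
  exact h

theorem sum_norm_sq_col {W : Matrix k k ℂ} (hW : Wᴴ * W = 1) (j : k) :
    ∑ i, ‖W i j‖ ^ 2 = 1 := by
  have h := sum_norm_sq_row (W := Wᴴ) (by rwa [conjTranspose_conjTranspose]) j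
  simpa using h

/-- The Peierls inequality for the convex function `t ↦ t ^ s`. -/
theorem sum_conj_unitary_diag_rpow_le {H : Matrix k k ℂ} (hH : H.PosSemidef) {U : Matrix k k ℂ}
    (hU : Uᴴ * U = 1) {s : ℝ} (hs : 1 ≤ s) :
    ∑ i, ((Uᴴ * H * U) i i).re ^ s ≤ ∑ j, hH.isHermitian.eigenvalues j ^ s := by
  set V := (hH.isHermitian.eigenvectorUnitary : Matrix k k ℂ) with hV
  have hV1 : Vᴴ * V = 1 := Unitary.coe_star_mul_self hH.isHermitian.eigenvectorUnitary
  have hV2 : V * Vᴴ = 1 := mul_eq_one_comm.mp hV1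
  have hU2 : U * Uᴴ = 1 := mul_eq_one_comm.mp hU
  have hW1 : (Uᴴ * V) * (Uᴴ * V)ᴴ = 1 := by
    rw [conjTranspose_mul, conjTranspose_conjTranspose, Matrix.mul_assoc, ← Matrix.mul_assoc V,
      hV2, Matrix.one_mul, hU]
  have hW2 : (Uᴴ * V)ᴴ * (Uᴴ * V) = 1 := mul_eq_one_comm.mp hW1
  calc ∑ i, ((Uᴴ * H * U) i i).re ^ s
      ≤ ∑ i, ∑ j, ‖(Uᴴ * V) i j‖ ^ 2 * hH.isHermitian.eigenvalues j ^ s := by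
        refine Finset.sum_le_sum fun i _ => ?_
        rw [conj_unitary_diag_re hH.isHermitian]
        exact Real.rpow_arith_mean_le_arith_mean_rpow _ _ _ (fun j _ => by positivity)
          (sum_norm_sq_row hW1 i) (fun j _ => hH.eigenvalues_nonneg j) hs
    _ = ∑ j, hH.isHermitian.eigenvalues j ^ s := by
        rw [Finset.sum_comm]
        refine Finset.sum_congr rfl fun j _ => ?_
        rw [← Finset.sum_mul, sum_norm_sq_col hW2, one_mul]

theorem conj_eigenvectorUnitary_diag_re {H : Matrix k k ℂ} (hH : H.IsHermitian) (i : k) :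
    (((hH.eigenvectorUnitary : Matrix k k ℂ)ᴴ * H * (hH.eigenvectorUnitary : Matrix k k ℂ)) i i).re
      = hH.eigenvalues i := by
  have hV1 : (hH.eigenvectorUnitary : Matrix k k ℂ)ᴴ * (hH.eigenvectorUnitary : Matrix k k ℂ) = 1 :=
    Unitary.coe_star_mul_self hH.eigenvectorUnitary
  rw [conj_unitary_diag_re hH, hV1]
  simp [one_apply, apply_ite, ite_pow]

omit [Fintype k] [DecidableEq k] [DecidableEq l] in
theorem ptrace2_posSemidef {A : Matrix (k × l) (k × l) ℂ} (hA : A.PosSemidef) :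
    (ptrace2 A).PosSemidef := by
  have : ptrace2 A = ∑ j : l, A.submatrix (fun a => (a, j)) (fun a => (a, j)) := by
    ext a b
    simp [ptrace2, Matrix.sum_apply]
  rw [this]
  exact posSemidef_sum _ fun j _ => hA.submatrix _

omit [DecidableEq k] [DecidableEq l] in
theorem contractRow_sub (U : Matrix k k ℂ) (i : k) (A B : Matrix (k × l) (k × l) ℂ) :
    contractRow U i (A - B) = contractRow U i A - contractRow U i B := by
  ext z
  simp [contractRow, mul_sub, Finset.sum_sub_distrib]

omit [DecidableEq k] [DecidableEq l] in
theorem norm_contractRow_sq (U : Matrix k k ℂ) (i : k) {A : Matrix (k × l) (k × l) ℂ}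
    (hA : A.IsHermitian) :
    ‖contractRow U i A‖ ^ 2 = ((Uᴴ * ptrace2 (A * A) * U) i i).re := by
  have key : (((‖contractRow U i A‖ ^ 2 : ℝ)) : ℂ) = (Uᴴ * ptrace2 (A * A) * U) i i := by
    have h1 : (((‖contractRow U i A‖ ^ 2 : ℝ)) : ℂ) = ∑ z : l × (k × l),
        (∑ a, star (U a i) * A (a, z.1) z.2) * star (∑ a, star (U a i) * A (a, z.1) z.2) := by
      rw [EuclideanSpace.norm_sq_eq, Complex.ofReal_sum]
      refine Finset.sum_congr rfl fun z _ => ?_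
      rw [RCLike.star_def, Complex.mul_conj, Complex.normSq_eq_norm_sq]
      rfl
    have h2 : ∀ z w, star (A z w) = A w z := fun z w => hA.apply w z
    rw [h1]
    simp only [Matrix.mul_apply, ptrace2, conjTranspose_apply, star_sum, star_mul', star_star, h2]
    calc _ = ∑ z : l × (k × l), ∑ b, ∑ a,
          star (U a i) * (A (a, z.1) z.2 * A z.2 (b, z.1)) * U b i := by
          refine Finset.sum_congr rfl fun z _ => ?_
          rw [Finset.mul_sum]
          refine Finset.sum_congr rfl fun b _ => ?_
          rw [Finset.sum_mul]
          exact Finset.sum_congr rfl fun a _ => by ring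
      _ = ∑ b, ∑ a, ∑ z : l × (k × l),
          star (U a i) * (A (a, z.1) z.2 * A z.2 (b, z.1)) * U b i := by
          rw [Finset.sum_comm]
          exact Finset.sum_congr rfl fun b _ => Finset.sum_comm
      _ = _ := by
          refine Finset.sum_congr rfl fun b _ => ?_
          rw [Finset.sum_mul]
          refine Finset.sum_congr rfl fun a _ => ?_
          rw [← Fintype.sum_prod_type' (f := fun j w => A (a, j) w * A w (b, j)), Finset.mul_sum,
            Finset.sum_mul]
  rw [← key, Complex.ofReal_re]

theorem Psi_two_eq (q : ℝ) {A : Matrix (k × l) (k × l) ℂ} (hA : A.IsHermitian)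
    (hH : (ptrace2 (A * A)).IsHermitian) :
    Psi 2 q A = (∑ i, hH.eigenvalues i ^ (q / 2)) ^ (1 / q) := by
  rw [Psi, mrpow_two hA, re_trace_mrpow hH]

omit [DecidableEq k] in
theorem Matrix.IsHermitian.mul_self_posSemidef {A : Matrix k k ℂ} (hA : A.IsHermitian) :
    (A * A).PosSemidef := by
  simpa [hA.eq] using posSemidef_conjTranspose_mul_self A

theorem sum_norm_contractRow_le_Psi {q : ℝ} (hq : 2 ≤ q) {A : Matrix (k × l) (k × l) ℂ}
    (hA : A.IsHermitian) {U : Matrix k k ℂ} (hU : Uᴴ * U = 1) :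
    (∑ i, ‖contractRow U i A‖ ^ q) ^ (1 / q) ≤ Psi 2 q A := by
  have hH : (ptrace2 (A * A)).PosSemidef := ptrace2_posSemidef hA.mul_self_posSemidef
  rw [Psi_two_eq q hA hH.isHermitian]
  refine Real.rpow_le_rpow (by positivity) ?_ (by positivity)
  refine le_trans (le_of_eq ?_) (sum_conj_unitary_diag_rpow_le hH hU (s := q / 2) (by linarith))
  refine Finset.sum_congr rfl fun i _ => ?_
  rw [← norm_contractRow_sq U i hA, ← Real.rpow_natCast, ← Real.rpow_mul (norm_nonneg _)]
  congr 1
  push_cast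
  ring

omit [Fintype k] [DecidableEq k] [Fintype l] [DecidableEq l] in
theorem clBlock_isHermitian (Y : Matrix (k × l) (k × l) ℂ) : (clBlock Y).IsHermitian := by
  ext ⟨a, b, c⟩ ⟨a', b', c'⟩
  fin_cases c <;> fin_cases c' <;> simp [clBlock]

omit [DecidableEq k] [DecidableEq l] in
theorem ptrace2_clBlock_sq {Y : Matrix (k × l) (k × l) ℂ} (hY : Y.IsHermitian) :
    ptrace2 (clBlock Y * clBlock Y) = (2 : ℂ) • ptrace2 (Y * Y) := by
  have h : ∀ z w, (starRingEnd ℂ) (Y z w) = Y w z := fun z w => hY.apply w z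
  ext a a'
  simp [ptrace2, Matrix.mul_apply, Fintype.sum_prod_type, clBlock, h, Finset.sum_add_distrib,
    two_mul]

theorem exists_posSemidef_add_eq {X : Matrix k k ℂ} (hX : X.IsHermitian) :
    ∃ A B : Matrix k k ℂ, A.PosSemidef ∧ B.PosSemidef ∧ X + A = B := by
  have h1 : (X - 1).IsHermitian := hX.sub isHermitian_one
  have h2 : (X + 1).IsHermitian := hX.add isHermitian_one
  refine ⟨(1 / 4 : ℝ) • ((X - 1) * (X - 1)), (1 / 4 : ℝ) • ((X + 1) * (X + 1)),
    h1.mul_self_posSemidef.smul (by norm_num), h2.mul_self_posSemidef.smul (by norm_num), ?_⟩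
  have : (X + 1) * (X + 1) = (X - 1) * (X - 1) + (4 : ℝ) • X := by
    have : (4 : ℝ) • X = X + X + X + X := by module
    rw [this]
    noncomm_ring
  rw [this, smul_add, smul_smul]
  norm_num [add_comm]

/-- Any two positive parts of a decomposition of `clBlock Y` dominate `√2 Ψ_{2,q}(Y)`: the triangle
inequality row by row in an eigenbasis of `Tr₂ Y²`, then Minkowski and Peierls. -/
theorem sqrt_two_mul_Psi_le {q : ℝ} (hq : 2 ≤ q) {Y : Matrix (k × l) (k × l) ℂ}
    (hY : Y.IsHermitian) {A B : Matrix (k × (l × Fin 2)) (k × (l × Fin 2)) ℂ}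
    (hA : A.IsHermitian) (hB : B.IsHermitian) (hAB : clBlock Y + A = B) :
    Real.sqrt 2 * Psi 2 q Y ≤ Psi 2 q A + Psi 2 q B := by
  have hG : (ptrace2 (Y * Y)).PosSemidef := ptrace2_posSemidef hY.mul_self_posSemidef
  set U := (hG.isHermitian.eigenvectorUnitary : Matrix k k ℂ) with hUdef
  have hU : Uᴴ * U = 1 := Unitary.coe_star_mul_self hG.isHermitian.eigenvectorUnitary
  set g := hG.isHermitian.eigenvalues
  have hg : ∀ i, 0 ≤ g i := hG.eigenvalues_nonneg
  have hq0 : q ≠ 0 := by linarith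
  have hX : ∀ i, ‖contractRow U i (clBlock Y)‖ = Real.sqrt 2 * Real.sqrt (g i) := by
    intro i
    rw [← Real.sqrt_mul (by norm_num), eq_comm,
      Real.sqrt_eq_iff_eq_sq (by have := hg i; positivity) (norm_nonneg _),
      norm_contractRow_sq U i (clBlock_isHermitian Y), ptrace2_clBlock_sq hY, Matrix.mul_smul,
      Matrix.smul_mul, Matrix.smul_apply, smul_eq_mul]
    have := conj_eigenvectorUnitary_diag_re hG.isHermitian i
    simp only [Complex.mul_re, Complex.re_ofNat, Complex.im_ofNat, zero_mul, sub_zero]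
    rw [this]
  have hle : ∀ i, Real.sqrt 2 * Real.sqrt (g i) ≤ ‖contractRow U i A‖ + ‖contractRow U i B‖ := by
    intro i
    rw [← hX, eq_sub_of_add_eq hAB, contractRow_sub, add_comm]
    exact norm_sub_le _ _
  calc Real.sqrt 2 * Psi 2 q Y = (∑ i, (Real.sqrt 2 * Real.sqrt (g i)) ^ q) ^ (1 / q) := by
        have h : ∀ i, (Real.sqrt 2 * Real.sqrt (g i)) ^ q = Real.sqrt 2 ^ q * g i ^ (q / 2) := by
          intro i
          rw [Real.mul_rpow (Real.sqrt_nonneg _) (Real.sqrt_nonneg _), Real.sqrt_eq_rpow (g i),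
            ← Real.rpow_mul (hg i)]
          congr 2
          ring
        simp_rw [h]
        rw [← Finset.mul_sum, Real.mul_rpow (by positivity)
          (Finset.sum_nonneg fun i _ => Real.rpow_nonneg (hg i) _), one_div,
          Real.rpow_rpow_inv (Real.sqrt_nonneg _) hq0, Psi_two_eq q hY hG.isHermitian, one_div]
    _ ≤ (∑ i, (‖contractRow U i A‖ + ‖contractRow U i B‖) ^ q) ^ (1 / q) := by
        refine Real.rpow_le_rpow (by positivity) (Finset.sum_le_sum fun i _ => ?_) (by positivity)
        exact Real.rpow_le_rpow (by positivity) (hle i) (by linarith)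
    _ ≤ (∑ i, ‖contractRow U i A‖ ^ q) ^ (1 / q) + (∑ i, ‖contractRow U i B‖ ^ q) ^ (1 / q) :=
        Real.Lp_add_le_of_nonneg _ (by linarith) (fun i _ => norm_nonneg _)
          (fun i _ => norm_nonneg _)
    _ ≤ Psi 2 q A + Psi 2 q B :=
        add_le_add (sum_norm_contractRow_le_Psi hq hA hU) (sum_norm_contractRow_le_Psi hq hB hU)

end

/-- **Lower bound for the Carlen–Lieb norm at `p = 2 ≤ q`**:
`‖Y‖_CL ≥ (1/√2) Ψ_{2,q}(Y)` for positive semidefinite `Y`. -/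
theorem clNorm_ge_psi {n m : ℕ} (hn : 0 < n) (hm : 0 < m) (q : ℝ) (hq : 2 ≤ q)
    (Y : Matrix (Fin n × Fin m) (Fin n × Fin m) ℂ) (hY : Y.PosSemidef) :
    (1 / Real.sqrt 2) * Psi 2 q Y ≤ clNorm 2 q Y := by
  have hconst : (1 / Real.sqrt 2) * Psi 2 q Y = (1 / 2) * (Real.sqrt 2 * Psi 2 q Y) := by
    have h2 : Real.sqrt 2 * Real.sqrt 2 = 2 := Real.mul_self_sqrt (by norm_num)
    have h0 : Real.sqrt 2 ≠ 0 := by positivity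
    field_simp
    linear_combination (-Psi 2 q Y) * h2
  rw [hconst, clNorm, tripleNorm]
  refine mul_le_mul_of_nonneg_left (le_csInf ?_ ?_) (by norm_num)
  · obtain ⟨A, B, hA, hB, hAB⟩ := exists_posSemidef_add_eq (clBlock_isHermitian Y)
    exact ⟨_, A, B, hA, hB, hAB, rfl⟩
  · rintro s ⟨A, B, hA, hB, hAB, rfl⟩
    exact sqrt_two_mul_Psi_le hq hY.isHermitian hA.isHermitian hB.isHermitian hAB
end

section
/- Let 1 ≤ p ≤ q ≤ ∞ with p < q and set 1/r = 1/p − 1/q. For every positive semidefinite Y ∈ M_n ⊗ M_m, the NC norm reduces to a supremum over density matrices: ‖Y‖_{NC:p,q} = sup{ ‖(C^{1/2r} ⊗ I_m) Y (C^{1/2r} ⊗ I_m)‖_p : C ∈ M_n, C ≥ 0, Tr C = 1 }. -/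
open scoped Kronecker
open Matrix
open scoped ENNReal NNReal ComplexOrder

/-- The sum of `f` over the (real parts of the) eigenvalues of a complex matrix, counted with
algebraic multiplicity. -/
noncomputable def specSum {k : Type*} [Fintype k] [DecidableEq k] (f : ℝ → ℝ)
    (A : Matrix k k ℂ) : ℝ :=
  (A.charpoly.roots.map (fun z => f z.re)).sum

section specSum

variable {k : Type*} [Fintype k] [DecidableEq k]

lemma specSum_eq_sum_eigenvalues (f : ℝ → ℝ) {A : Matrix k k ℂ} (hA : A.IsHermitian) :
    specSum f A = ∑ i, f (hA.eigenvalues i) := by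
  rw [specSum, hA.roots_charpoly_eq_eigenvalues, Multiset.map_map]
  rfl

lemma specSum_mul_comm (f : ℝ → ℝ) (A B : Matrix k k ℂ) :
    specSum f (A * B) = specSum f (B * A) := by
  rw [specSum, specSum, Matrix.charpoly_mul_comm]

lemma specSum_cfc (f g : ℝ → ℝ) {A : Matrix k k ℂ} (hA : A.IsHermitian) :
    specSum f (cfc g A) = ∑ i, f (g (hA.eigenvalues i)) := by
  rw [specSum, hA.charpoly_cfc_eq, Polynomial.roots_prod _ _
    (Finset.prod_ne_zero_iff.mpr fun i _ => Polynomial.X_sub_C_ne_zero _)]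
  simp

lemma specSum_rpow_nonneg (p : ℝ) {A : Matrix k k ℂ} (hA : A.PosSemidef) :
    0 ≤ specSum (fun x => x ^ p) A := by
  rw [specSum_eq_sum_eigenvalues _ hA.isHermitian]
  exact Finset.sum_nonneg fun i _ => Real.rpow_nonneg (hA.eigenvalues_nonneg i) _

lemma specSum_rpow_smul (p : ℝ) {c : ℝ} (hc : 0 ≤ c) {A : Matrix k k ℂ} (hA : A.PosSemidef) :
    specSum (fun x => x ^ p) (c • A) = c ^ p * specSum (fun x => x ^ p) A := by
  have h : c • A = cfc (fun x : ℝ => c * x) A :=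
    (cfc_const_mul_id c A hA.isHermitian.isSelfAdjoint).symm
  rw [h, specSum_cfc _ _ hA.isHermitian, specSum_eq_sum_eigenvalues _ hA.isHermitian,
    Finset.mul_sum]
  exact Finset.sum_congr rfl fun i _ => Real.mul_rpow hc (hA.eigenvalues_nonneg i)

lemma specSum_rpow_half_sq (p : ℝ) {A : Matrix k k ℂ} (hA : A.PosSemidef) :
    specSum (fun x => x ^ (p / 2)) (A * A) = specSum (fun x => x ^ p) A := by
  have h : A * A = cfc (fun x : ℝ => x ^ 2) A := by
    rw [cfc_pow_id A 2 hA.isHermitian.isSelfAdjoint, sq]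
  rw [h, specSum_cfc _ _ hA.isHermitian, specSum_eq_sum_eigenvalues _ hA.isHermitian]
  refine Finset.sum_congr rfl fun i _ => ?_
  rw [← Real.rpow_natCast, ← Real.rpow_mul (hA.eigenvalues_nonneg i)]
  congr 1
  push_cast
  ring

lemma schattenNorm_eq_specSum {p : ℝ≥0∞} (hp : p ≠ ⊤) (A : Matrix k k ℂ) :
    schattenNorm p A = specSum (fun x => x ^ (p.toReal / 2)) (Aᴴ * A) ^ (1 / p.toReal) := by
  rw [schattenNorm, if_neg hp,
    specSum_eq_sum_eigenvalues _ (Matrix.posSemidef_conjTranspose_mul_self A).isHermitian]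

lemma schattenNorm_nonneg {p : ℝ≥0∞} (hp : p ≠ ⊤) (A : Matrix k k ℂ) : 0 ≤ schattenNorm p A := by
  rw [schattenNorm_eq_specSum hp]
  exact Real.rpow_nonneg (specSum_rpow_nonneg _ (Matrix.posSemidef_conjTranspose_mul_self A)) _

lemma schattenNorm_mul_conjTranspose {p : ℝ≥0∞} (hp : p ≠ ⊤) (L : Matrix k k ℂ) :
    schattenNorm p (L * Lᴴ) = specSum (fun x => x ^ p.toReal) (Lᴴ * L) ^ (1 / p.toReal) := by
  have h : (L * Lᴴ).PosSemidef := Matrix.posSemidef_self_mul_conjTranspose L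
  rw [schattenNorm_eq_specSum hp, h.isHermitian.eq, specSum_rpow_half_sq _ h, specSum_mul_comm]

lemma eigenvalues_le_trace {A : Matrix k k ℂ} (hA : A.PosSemidef) (i : k) :
    hA.isHermitian.eigenvalues i ≤ A.trace.re := by
  rw [hA.isHermitian.trace_eq_sum_eigenvalues]
  simp only [Complex.re_sum]
  exact Finset.single_le_sum (f := fun i => hA.isHermitian.eigenvalues i)
    (fun j _ => hA.eigenvalues_nonneg j) (Finset.mem_univ i)

lemma mrpow_eq_cfc {A : Matrix k k ℂ} (hA : A.IsHermitian) (e : ℝ) :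
    mrpow A e = cfc (fun x : ℝ => x ^ e) A := by
  rw [mrpow, dif_pos hA, hA.cfc_eq, Matrix.IsHermitian.cfc, Unitary.conjStarAlgAut_apply]
  rfl

lemma isHermitian_mrpow {A : Matrix k k ℂ} (hA : A.IsHermitian) (e : ℝ) :
    (mrpow A e).IsHermitian := by
  rw [mrpow_eq_cfc hA]
  exact cfc_predicate (p := IsSelfAdjoint) (fun x : ℝ => x ^ e) A

lemma continuousOn_spectrum (f : ℝ → ℝ) (A : Matrix k k ℂ) :
    ContinuousOn f (spectrum ℝ A) :=
  Matrix.finite_real_spectrum.continuousOn f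

lemma posSemidef_cfc (f : ℝ → ℝ) {A : Matrix k k ℂ} (hA : A.IsHermitian)
    (hf : ∀ i, 0 ≤ f (hA.eigenvalues i)) : (cfc f A).PosSemidef := by
  rw [hA.cfc_eq, Matrix.IsHermitian.cfc, Unitary.conjStarAlgAut_apply]
  refine Matrix.PosSemidef.mul_mul_conjTranspose_same (Matrix.PosSemidef.diagonal ?_) _
  intro i
  simpa using hf i

lemma trace_eq_one_of_specSum {A : Matrix k k ℂ} (hA : A.IsHermitian)
    (h : specSum (fun x => x) A = 1) : A.trace = 1 := by
  rw [hA.trace_eq_sum_eigenvalues]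
  rw [specSum_eq_sum_eigenvalues _ hA] at h
  simp only [Complex.coe_algebraMap, ← Complex.ofReal_sum, h, Complex.ofReal_one]

/-- A nonzero positive semidefinite matrix is a multiple of the square of a power of a density
matrix. -/
lemma exists_density_mrpow_sq {r : ℝ} (hr : 0 < r) {H : Matrix k k ℂ} (hH : H.PosSemidef)
    (ha : 0 < specSum (fun x => x ^ r) H) :
    ∃ C : Matrix k k ℂ, C.PosSemidef ∧ C.trace = 1 ∧
      H = (specSum (fun x => x ^ r) H ^ (1 / r)) •
        (mrpow C (1 / (2 * r)) * mrpow C (1 / (2 * r))) := by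
  set a := specSum (fun x => x ^ r) H
  have hpos : ∀ i, 0 ≤ hH.isHermitian.eigenvalues i ^ r / a := fun i =>
    div_nonneg (Real.rpow_nonneg (hH.eigenvalues_nonneg i) _) ha.le
  have hC := posSemidef_cfc (fun x => x ^ r / a) hH.isHermitian hpos
  refine ⟨cfc (fun x : ℝ => x ^ r / a) H, hC, trace_eq_one_of_specSum hC.isHermitian ?_, ?_⟩
  · rw [specSum_cfc _ _ hH.isHermitian, ← Finset.sum_div, ← specSum_eq_sum_eigenvalues
      (fun x => x ^ r) hH.isHermitian, div_self ha.ne']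
  · rw [mrpow_eq_cfc hC.isHermitian,
      ← cfc_comp' (fun x : ℝ => x ^ (1 / (2 * r))) (fun x : ℝ => x ^ r / a) H
        ((Matrix.finite_real_spectrum.image _).continuousOn _)
        (continuousOn_spectrum _ _) hH.isHermitian.isSelfAdjoint,
      ← cfc_mul _ _ H (continuousOn_spectrum _ _)
        (continuousOn_spectrum _ _),
      ← cfc_const_mul _ _ H (continuousOn_spectrum _ _)]
    conv_lhs => rw [← cfc_id ℝ H hH.isHermitian.isSelfAdjoint]
    refine cfc_congr fun x hx => ?_
    rw [hH.isHermitian.spectrum_real_eq_range_eigenvalues] at hx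
    obtain ⟨i, rfl⟩ := hx
    have hx0 := hH.eigenvalues_nonneg i
    have h1 : 1 / (2 * r) + 1 / (2 * r) = 1 / r := by field_simp; norm_num
    have h2 : 1 / (2 * r) + 1 / (2 * r) ≠ 0 := by rw [h1]; positivity
    simp only [id]
    rw [← Real.rpow_add' (hpos i) h2, h1, Real.div_rpow (Real.rpow_nonneg hx0 _) ha.le,
      ← Real.rpow_mul hx0, mul_one_div_cancel hr.ne', Real.rpow_one,
      mul_div_cancel₀ _ (Real.rpow_pos_of_pos ha _).ne']

lemma posSemidef_one_sub_mrpow_sq {C : Matrix k k ℂ} (hC : C.PosSemidef) (htr : C.trace = 1)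
    {e : ℝ} (he : 0 ≤ e) : (1 - mrpow C e * mrpow C e).PosSemidef := by
  have hh := hC.isHermitian
  rw [mrpow_eq_cfc hh, ← cfc_mul _ _ C (continuousOn_spectrum _ _) (continuousOn_spectrum _ _),
    ← cfc_one ℝ C hh.isSelfAdjoint, ← cfc_sub _ _ C (continuousOn_spectrum _ _) (continuousOn_spectrum _ _)]
  refine posSemidef_cfc _ hh fun i => ?_
  have h0 := hC.eigenvalues_nonneg i
  have h1 := eigenvalues_le_trace hC i
  rw [htr, Complex.one_re] at h1
  have h2 := Real.rpow_le_one h0 h1 he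
  have h3 := Real.rpow_nonneg h0 e
  simp only [Pi.one_apply]
  nlinarith

open scoped MatrixOrder Matrix.Norms.L2Operator in
lemma exists_eq_conjTranspose_mul_self {A : Matrix k k ℂ} (hA : A.PosSemidef) :
    ∃ T : Matrix k k ℂ, A = Tᴴ * T :=
  CStarAlgebra.nonneg_iff_eq_star_mul_self.mp hA.nonneg

end specSum

section Holder

variable {k : Type*} [Fintype k]

lemma mul_conjTranspose_apply_self_re (G : Matrix k k ℂ) (i : k) :
    ((G * Gᴴ) i i).re = ∑ j, ‖G i j‖ ^ 2 := by
  simp [Matrix.mul_apply, Complex.mul_conj, Complex.normSq_eq_norm_sq, -Complex.ofReal_pow]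

lemma conjTranspose_mul_apply_self_re (G : Matrix k k ℂ) (j : k) :
    ((Gᴴ * G) j j).re = ∑ i, ‖G i j‖ ^ 2 := by
  simp [Matrix.mul_apply, mul_comm, Complex.mul_conj, Complex.normSq_eq_norm_sq,
    -Complex.ofReal_pow]

lemma norm_mul_apply_self_le (M N : Matrix k k ℂ) (i : k) :
    ‖(M * N) i i‖ ≤ √((M * Mᴴ) i i).re * √((Nᴴ * N) i i).re := by
  rw [mul_conjTranspose_apply_self_re, conjTranspose_mul_apply_self_re, Matrix.mul_apply]
  refine (norm_sum_le _ _).trans ?_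
  simp only [norm_mul]
  exact Real.sum_mul_le_sqrt_mul_sqrt _ _ _

lemma sum_rpow_mul_le {p : ℝ} (hp : 1 ≤ p) (s a : k → ℝ) (hs : ∀ i, 0 ≤ s i)
    (ha : ∀ i, 0 ≤ a i) :
    ∑ i, s i ^ ((p - 1) / 2) * a i ≤
      (∑ i, s i ^ (p / 2)) ^ (1 - 1 / p) * (∑ i, a i ^ p) ^ (1 / p) := by
  rcases hp.eq_or_lt with rfl | hp
  · simp
  have hc : (Real.conjExponent p).HolderConjugate p := (Real.HolderConjugate.conjExponent hp).symm
  have h := Real.inner_le_Lp_mul_Lq_of_nonneg Finset.univ hc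
    (f := fun i => s i ^ ((p - 1) / 2)) (g := a) (fun i _ => Real.rpow_nonneg (hs i) _)
    (fun i _ => ha i)
  have hp1 : p - 1 ≠ 0 := by linarith
  have hp0 : p ≠ 0 := by linarith
  have h1 : ∀ i, (s i ^ ((p - 1) / 2)) ^ Real.conjExponent p = s i ^ (p / 2) := fun i => by
    rw [← Real.rpow_mul (hs i), Real.conjExponent]
    congr 1
    field_simp
  have h2 : 1 / Real.conjExponent p = 1 - 1 / p := by
    rw [Real.conjExponent]; field_simp
  simpa only [h1, h2] using h

variable [DecidableEq k]

/-- Bessel's inequality for a matrix whose rows are orthogonal of norm at most one. -/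
lemma sum_col_norm_sq_le_one {G : Matrix k k ℂ} {e : k → ℝ} (he : ∀ i, e i ≤ 1)
    (hG : G * Gᴴ = Matrix.diagonal (fun i => (e i : ℂ))) (j : k) : ∑ i, ‖G i j‖ ^ 2 ≤ 1 := by
  have h1 : ∑ l, ‖(Gᴴ * G) j l‖ ^ 2 = ∑ i, e i * ‖G i j‖ ^ 2 := by
    have hH : (Gᴴ * G)ᴴ = Gᴴ * G := by simp
    rw [← mul_conjTranspose_apply_self_re, hH,
      show Gᴴ * G * (Gᴴ * G) = Gᴴ * (G * Gᴴ) * G by simp only [Matrix.mul_assoc], hG,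
      Matrix.mul_assoc, Matrix.mul_apply, Complex.re_sum]
    refine Finset.sum_congr rfl fun i _ => ?_
    rw [Matrix.diagonal_mul, Matrix.conjTranspose_apply, mul_left_comm]
    simp [mul_comm, Complex.mul_conj, Complex.normSq_eq_norm_sq, -Complex.ofReal_pow]
  have h2 : ∑ i, e i * ‖G i j‖ ^ 2 ≤ ∑ i, ‖G i j‖ ^ 2 :=
    Finset.sum_le_sum fun i _ => mul_le_of_le_one_left (by positivity) (he i)
  have h3 : ‖(Gᴴ * G) j j‖ ^ 2 ≤ ∑ l, ‖(Gᴴ * G) j l‖ ^ 2 :=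
    Finset.single_le_sum (f := fun l => ‖(Gᴴ * G) j l‖ ^ 2) (fun l _ => by positivity)
      (Finset.mem_univ j)
  have h4 := Complex.re_le_norm ((Gᴴ * G) j j)
  rw [conjTranspose_mul_apply_self_re] at h4
  have h5 : 0 ≤ ∑ i, ‖G i j‖ ^ 2 := Finset.sum_nonneg fun i _ => by positivity
  nlinarith

/-- Peierls' inequality for powers: diagonal entries in an orthonormal system. -/
lemma sum_diag_rpow_le_specSum {p : ℝ} (hp : 1 ≤ p) {P U : Matrix k k ℂ} (hP : P.PosSemidef)
    {e : k → ℝ} (he : ∀ i, e i = 0 ∨ e i = 1)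
    (hU : Uᴴ * U = Matrix.diagonal (fun i => (e i : ℂ))) :
    ∑ i, ((Uᴴ * P * U) i i).re ^ p ≤ specSum (fun x => x ^ p) P := by
  set E := (hP.isHermitian.eigenvectorUnitary : Matrix k k ℂ)
  set τ := hP.isHermitian.eigenvalues
  have hτ : ∀ j, 0 ≤ τ j := hP.eigenvalues_nonneg
  have hspec : P = E * Matrix.diagonal (fun i => (τ i : ℂ)) * Eᴴ := by
    conv_lhs => rw [hP.isHermitian.spectral_theorem, Unitary.conjStarAlgAut_apply]
    rfl
  have hEE : E * Eᴴ = 1 := Unitary.mul_star_self_of_mem hP.isHermitian.eigenvectorUnitary.2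
  set G := Uᴴ * E with hGdef
  have hG : G * Gᴴ = Matrix.diagonal (fun i => (e i : ℂ)) := by
    rw [hGdef, Matrix.conjTranspose_mul, Matrix.conjTranspose_conjTranspose, ← hU,
      Matrix.mul_assoc, ← Matrix.mul_assoc E, hEE, Matrix.one_mul]
  have hrow : ∀ i, ∑ j, ‖G i j‖ ^ 2 = e i := fun i => by
    rw [← mul_conjTranspose_apply_self_re, hG]; simp
  have hcol := sum_col_norm_sq_le_one (fun i => by rcases he i with h | h <;> rw [h]; norm_num) hG
  have hdiag : ∀ i, ((Uᴴ * P * U) i i).re = ∑ j, ‖G i j‖ ^ 2 * τ j := fun i => by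
    have : Uᴴ * P * U = G * Matrix.diagonal (fun i => (τ i : ℂ)) * Gᴴ := by
      rw [hGdef, Matrix.conjTranspose_mul, Matrix.conjTranspose_conjTranspose]
      conv_lhs => rw [hspec]
      simp only [Matrix.mul_assoc]
    rw [this, Matrix.mul_apply, Complex.re_sum]
    refine Finset.sum_congr rfl fun j _ => ?_
    rw [Matrix.mul_diagonal, Matrix.conjTranspose_apply, mul_right_comm]
    simp [Complex.mul_conj, Complex.normSq_eq_norm_sq, -Complex.ofReal_pow]
  have hjensen : ∀ i, ((Uᴴ * P * U) i i).re ^ p ≤ ∑ j, ‖G i j‖ ^ 2 * τ j ^ p := fun i => by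
    rw [hdiag]
    rcases he i with h | h
    · have hz : ∀ j, ‖G i j‖ ^ 2 = 0 := fun j =>
        (Finset.sum_eq_zero_iff_of_nonneg (fun j _ => by positivity)).mp ((hrow i).trans h) j
          (Finset.mem_univ j)
      simp only [hz, zero_mul, Finset.sum_const_zero]
      rw [Real.zero_rpow (by linarith)]
    · exact Real.rpow_arith_mean_le_arith_mean_rpow _ _ _ (fun j _ => by positivity)
        ((hrow i).trans h) (fun j _ => hτ j) hp
  calc _ ≤ ∑ i, ∑ j, ‖G i j‖ ^ 2 * τ j ^ p := Finset.sum_le_sum fun i _ => hjensen i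
    _ = ∑ j, (∑ i, ‖G i j‖ ^ 2) * τ j ^ p := by
      rw [Finset.sum_comm]; simp only [Finset.sum_mul]
    _ ≤ ∑ j, τ j ^ p := Finset.sum_le_sum fun j _ =>
      mul_le_of_le_one_left (Real.rpow_nonneg (hτ j) _) (hcol j)
    _ = _ := (specSum_eq_sum_eigenvalues (fun x => x ^ p) hP.isHermitian).symm

/-- The singular value decomposition, in the form of an orthonormal system `U` and a
unitary `V` diagonalising `Xᴴ * X`. -/
lemma exists_svd (X : Matrix k k ℂ) {s : k → ℝ}
    (hs : s = (Matrix.posSemidef_conjTranspose_mul_self X).isHermitian.eigenvalues) :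
    ∃ U V : Matrix k k ℂ, ∃ e : k → ℝ, (∀ i, e i = 0 ∨ e i = 1) ∧
      Uᴴ * U = Matrix.diagonal (fun i => (e i : ℂ)) ∧ Vᴴ * V = 1 ∧
      Uᴴ * X * V = Matrix.diagonal (fun i => ((s i ^ (1 / 2 : ℝ) : ℝ) : ℂ)) := by
  have hP := Matrix.posSemidef_conjTranspose_mul_self X
  have hs0 : ∀ i, 0 ≤ s i := fun i => by rw [hs]; exact hP.eigenvalues_nonneg i
  set V := (hP.isHermitian.eigenvectorUnitary : Matrix k k ℂ)
  have hVV : Vᴴ * V = 1 := Unitary.star_mul_self_of_mem hP.isHermitian.eigenvectorUnitary.2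
  have hspec : Xᴴ * X = V * Matrix.diagonal (fun i => (s i : ℂ)) * Vᴴ := by
    conv_lhs => rw [hP.isHermitian.spectral_theorem, Unitary.conjStarAlgAut_apply]
    rw [hs]; rfl
  have hW : (X * V)ᴴ * (X * V) = Matrix.diagonal (fun i => (s i : ℂ)) := by
    rw [Matrix.conjTranspose_mul, Matrix.mul_assoc, ← Matrix.mul_assoc Xᴴ, hspec]
    simp only [Matrix.mul_assoc, hVV, Matrix.mul_one]
    rw [← Matrix.mul_assoc, hVV, Matrix.one_mul]
  set D : Matrix k k ℂ := Matrix.diagonal (fun i => ((s i ^ (-(1 / 2) : ℝ) : ℝ) : ℂ)) with hD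
  have hDH : Dᴴ = D := by
    rw [hD, Matrix.diagonal_conjTranspose]
    congr 1
    ext i
    simp
  have hX : (X * V * D)ᴴ * X * V = Matrix.diagonal (fun i => ((s i ^ (1 / 2 : ℝ) : ℝ) : ℂ)) := by
    rw [Matrix.mul_assoc, Matrix.conjTranspose_mul, Matrix.mul_assoc, hW, hDH, hD,
      Matrix.diagonal_mul_diagonal]
    congr 1
    ext i
    rw [← Complex.ofReal_mul]
    congr 1
    rcases (hs0 i).eq_or_lt with h | h
    · rw [← h, Real.zero_rpow (by norm_num), Real.zero_rpow (by norm_num), zero_mul]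
    · nth_rw 2 [← Real.rpow_one (s i)]
      rw [← Real.rpow_add h]
      norm_num
  refine ⟨X * V * D, V, fun i => s i ^ (1 / 2 : ℝ) * s i ^ (-(1 / 2) : ℝ), fun i => ?_, ?_, hVV,
    hX⟩
  · beta_reduce
    rcases (hs0 i).eq_or_lt with h | h
    · left; rw [← h, Real.zero_rpow (by norm_num), zero_mul]
    · right; rw [← Real.rpow_add h]; simp
  · rw [← Matrix.mul_assoc, ← Matrix.mul_assoc, hX, hD, Matrix.diagonal_mul_diagonal]
    simp only [Complex.ofReal_mul]

/-- Hölder's inequality for Schatten norms with exponents `2p`, `2p`. -/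
theorem schattenNorm_mul_le {p : ℝ≥0∞} (hp : 1 ≤ p) (hp' : p ≠ ⊤) (M N : Matrix k k ℂ) :
    schattenNorm p (M * N) ≤
      √(specSum (fun x => x ^ p.toReal) (Mᴴ * M) ^ (1 / p.toReal)) *
        √(specSum (fun x => x ^ p.toReal) (N * Nᴴ) ^ (1 / p.toReal)) := by
  have hP1 : 1 ≤ p.toReal := by simpa using ENNReal.toReal_mono hp' hp
  set P := p.toReal
  rw [specSum_mul_comm _ Mᴴ, specSum_mul_comm _ N]
  have hpsd := Matrix.posSemidef_conjTranspose_mul_self (M * N)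
  obtain ⟨s, hs⟩ : ∃ s, s = hpsd.isHermitian.eigenvalues := ⟨_, rfl⟩
  have hs0 : ∀ i, 0 ≤ s i := fun i => by rw [hs]; exact hpsd.eigenvalues_nonneg i
  obtain ⟨U, V, e, he, hU, hV, hUV⟩ := exists_svd (M * N) hs
  have hM := Matrix.posSemidef_self_mul_conjTranspose M
  have hN := Matrix.posSemidef_conjTranspose_mul_self N
  set α : k → ℝ := fun i => ((Uᴴ * (M * Mᴴ) * U) i i).re
  set β : k → ℝ := fun i => ((Vᴴ * (Nᴴ * N) * V) i i).re
  have hα0 : ∀ i, 0 ≤ α i := fun i =>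
    (Complex.nonneg_iff.mp (hM.conjTranspose_mul_mul_same U).diag_nonneg).1
  have hβ0 : ∀ i, 0 ≤ β i := fun i =>
    (Complex.nonneg_iff.mp (hN.conjTranspose_mul_mul_same V).diag_nonneg).1
  set a := specSum (fun x => x ^ P) (M * Mᴴ)
  set b := specSum (fun x => x ^ P) (Nᴴ * N)
  have ha : ∑ i, α i ^ P ≤ a := sum_diag_rpow_le_specSum hP1 hM he hU
  have hb : ∑ i, β i ^ P ≤ b := sum_diag_rpow_le_specSum hP1 hN (e := fun _ => 1)
    (fun _ => Or.inr rfl) (by rw [hV]; simp)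
  have ha0 : 0 ≤ a := specSum_rpow_nonneg _ hM
  have hb0 : 0 ≤ b := specSum_rpow_nonneg _ hN
  set S := ∑ i, s i ^ (P / 2) with hS
  have hS0 : 0 ≤ S := Finset.sum_nonneg fun i _ => Real.rpow_nonneg (hs0 i) _
  have hnorm : schattenNorm p (M * N) = S ^ (1 / P) := by
    rw [schattenNorm_eq_specSum hp', specSum_eq_sum_eigenvalues _ hpsd.isHermitian, hS, hs]
  have hc : ∀ i, 0 ≤ s i ^ ((P - 1) / 2) := fun i => Real.rpow_nonneg (hs0 i) _
  have hsing : ∀ i, s i ^ (1 / 2 : ℝ) ≤ √(α i) * √(β i) := fun i => by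
    have h := norm_mul_apply_self_le (Uᴴ * M) (N * V) i
    have h1 : Uᴴ * M * (N * V) = Uᴴ * (M * N) * V := by simp only [Matrix.mul_assoc]
    have h2 : Uᴴ * M * (Uᴴ * M)ᴴ = Uᴴ * (M * Mᴴ) * U := by
      simp only [Matrix.mul_assoc, Matrix.conjTranspose_mul, Matrix.conjTranspose_conjTranspose]
    have h3 : (N * V)ᴴ * (N * V) = Vᴴ * (Nᴴ * N) * V := by
      simp only [Matrix.mul_assoc, Matrix.conjTranspose_mul]
    rw [h1, h2, h3, hUV, Matrix.diagonal_apply_eq, Complex.norm_real, Real.norm_eq_abs,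
      abs_of_nonneg (Real.rpow_nonneg (hs0 i) _)] at h
    exact h
  have hbound : ∀ x : k → ℝ, (∀ i, 0 ≤ x i) → ∀ y, ∑ i, x i ^ P ≤ y →
      ∑ i, s i ^ ((P - 1) / 2) * x i ≤ S ^ (1 - 1 / P) * y ^ (1 / P) := fun x hx y hy =>
    (sum_rpow_mul_le hP1 s x hs0 hx).trans <| mul_le_mul_of_nonneg_left
      (Real.rpow_le_rpow (Finset.sum_nonneg fun i _ => Real.rpow_nonneg (hx i) _) hy
        (by positivity)) (Real.rpow_nonneg hS0 _)
  have key : S ≤ S ^ (1 - 1 / P) * (√(a ^ (1 / P)) * √(b ^ (1 / P))) := by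
    calc S = ∑ i, s i ^ ((P - 1) / 2) * s i ^ (1 / 2 : ℝ) := by
          refine Finset.sum_congr rfl fun i _ => ?_
          rw [← Real.rpow_add_of_nonneg (hs0 i) (by linarith) (by norm_num)]
          congr 1
          ring
      _ ≤ ∑ i, √(s i ^ ((P - 1) / 2) * α i) * √(s i ^ ((P - 1) / 2) * β i) := by
          refine Finset.sum_le_sum fun i _ => ?_
          rw [Real.sqrt_mul (hc i), Real.sqrt_mul (hc i), mul_mul_mul_comm,
            Real.mul_self_sqrt (hc i)]
          exact mul_le_mul_of_nonneg_left (hsing i) (hc i)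
      _ ≤ √(∑ i, s i ^ ((P - 1) / 2) * α i) * √(∑ i, s i ^ ((P - 1) / 2) * β i) :=
          Real.sum_sqrt_mul_sqrt_le _ (fun i => mul_nonneg (hc i) (hα0 i))
            (fun i => mul_nonneg (hc i) (hβ0 i))
      _ ≤ √(S ^ (1 - 1 / P) * a ^ (1 / P)) * √(S ^ (1 - 1 / P) * b ^ (1 / P)) :=
          mul_le_mul (Real.sqrt_le_sqrt (hbound α hα0 a ha))
            (Real.sqrt_le_sqrt (hbound β hβ0 b hb)) (Real.sqrt_nonneg _) (Real.sqrt_nonneg _)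
      _ = _ := by
          have hSn := Real.rpow_nonneg hS0 (1 - 1 / P)
          rw [Real.sqrt_mul hSn, Real.sqrt_mul hSn, mul_mul_mul_comm, Real.mul_self_sqrt hSn]
  rw [hnorm]
  rcases hS0.eq_or_lt with h | h
  · rw [← h, Real.zero_rpow (by positivity)]
    positivity
  · have hSp : 0 < S ^ (1 - 1 / P) := Real.rpow_pos_of_pos h _
    refine le_of_mul_le_mul_left ?_ hSp
    rw [← Real.rpow_add h, sub_add_cancel, Real.rpow_one]
    exact key

end Holder

section Sandwich

lemma conjTranspose_kronecker_one {k l : Type*} [DecidableEq l] (A : Matrix k k ℂ) :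
    (A ⊗ₖ (1 : Matrix l l ℂ))ᴴ = Aᴴ ⊗ₖ (1 : Matrix l l ℂ) := by
  rw [Matrix.conjTranspose_kronecker, Matrix.conjTranspose_one]

variable {k l : Type*} [Fintype k] [Fintype l] [DecidableEq l]

lemma kronecker_one_mul_kronecker_one (A B : Matrix k k ℂ) :
    A ⊗ₖ (1 : Matrix l l ℂ) * B ⊗ₖ (1 : Matrix l l ℂ) = (A * B) ⊗ₖ (1 : Matrix l l ℂ) := by
  rw [← Matrix.mul_kronecker_mul, Matrix.one_mul]

lemma posSemidef_sandwich (T : Matrix (k × l) (k × l) ℂ) {H : Matrix k k ℂ} (hH : H.PosSemidef) :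
    (T * (H ⊗ₖ (1 : Matrix l l ℂ)) * Tᴴ).PosSemidef :=
  (hH.kronecker Matrix.PosSemidef.one).mul_mul_conjTranspose_same T

variable [DecidableEq k]

/-- The Schatten `p`-norm of `T (H ⊗ I) Tᴴ`, for `H` positive semidefinite. -/
noncomputable def sandwichNorm (p : ℝ) (T : Matrix (k × l) (k × l) ℂ) (H : Matrix k k ℂ) : ℝ :=
  specSum (fun x => x ^ p) (T * (H ⊗ₖ (1 : Matrix l l ℂ)) * Tᴴ) ^ (1 / p)

lemma sandwichNorm_smul {p : ℝ} (hp : p ≠ 0) (T : Matrix (k × l) (k × l) ℂ) {H : Matrix k k ℂ}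
    (hH : H.PosSemidef) {c : ℝ} (hc : 0 ≤ c) :
    sandwichNorm p T (c • H) = c * sandwichNorm p T H := by
  have hpsd := posSemidef_sandwich T hH
  rw [sandwichNorm, Matrix.smul_kronecker, Matrix.mul_smul, Matrix.smul_mul,
    specSum_rpow_smul p hc hpsd,
    Real.mul_rpow (Real.rpow_nonneg hc _) (specSum_rpow_nonneg _ hpsd), ← Real.rpow_mul hc,
    mul_one_div_cancel hp, Real.rpow_one, sandwichNorm]

lemma schattenNorm_sandwich {p : ℝ≥0∞} (hp : p ≠ ⊤) (T : Matrix (k × l) (k × l) ℂ)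
    {K : Matrix k k ℂ} (hK : K.IsHermitian) :
    schattenNorm p ((K ⊗ₖ (1 : Matrix l l ℂ)) * (Tᴴ * T) * (K ⊗ₖ (1 : Matrix l l ℂ))) =
      sandwichNorm p.toReal T (K * K) := by
  have h := schattenNorm_mul_conjTranspose hp ((K ⊗ₖ (1 : Matrix l l ℂ)) * Tᴴ)
  simp only [Matrix.conjTranspose_mul, Matrix.conjTranspose_conjTranspose,
    conjTranspose_kronecker_one, hK.eq] at h
  rw [sandwichNorm, ← kronecker_one_mul_kronecker_one]
  simpa only [Matrix.mul_assoc] using h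

lemma schattenNorm_mul_mul_le {p : ℝ≥0∞} (hp : 1 ≤ p) (hp' : p ≠ ⊤)
    (T : Matrix (k × l) (k × l) ℂ) (A B : Matrix k k ℂ) :
    schattenNorm p ((A ⊗ₖ (1 : Matrix l l ℂ)) * (Tᴴ * T) * (B ⊗ₖ (1 : Matrix l l ℂ))) ≤
      √(sandwichNorm p.toReal T (Aᴴ * A)) * √(sandwichNorm p.toReal T (B * Bᴴ)) := by
  have h := schattenNorm_mul_le hp hp' ((A ⊗ₖ (1 : Matrix l l ℂ)) * Tᴴ)
    (T * (B ⊗ₖ (1 : Matrix l l ℂ)))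
  simp only [Matrix.conjTranspose_mul, Matrix.conjTranspose_conjTranspose,
    conjTranspose_kronecker_one] at h
  rw [sandwichNorm, sandwichNorm, ← kronecker_one_mul_kronecker_one,
    ← kronecker_one_mul_kronecker_one]
  simpa only [Matrix.mul_assoc] using h

lemma sandwichNorm_mrpow_sq_le {p : ℝ} (hp : 0 ≤ p) (T : Matrix (k × l) (k × l) ℂ)
    {C : Matrix k k ℂ} (hC : C.PosSemidef) (htr : C.trace = 1) {e : ℝ} (he : 0 ≤ e) :
    sandwichNorm p T (mrpow C e * mrpow C e) ≤
      (∑ _i : k × l, (T * Tᴴ).trace.re ^ p) ^ (1 / p) := by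
  set K := mrpow C e
  have hK : (K * K).PosSemidef := by
    have h := Matrix.posSemidef_conjTranspose_mul_self K
    rwa [(isHermitian_mrpow hC.isHermitian e).eq] at h
  have hZ := posSemidef_sandwich T hK
  have hd := posSemidef_sandwich T (posSemidef_one_sub_mrpow_sq hC htr he)
  have htrace : (T * ((K * K) ⊗ₖ (1 : Matrix l l ℂ)) * Tᴴ).trace.re ≤ (T * Tᴴ).trace.re := by
    have h0 := (Complex.nonneg_iff.mp hd.trace_nonneg).1
    rw [sub_eq_add_neg, Matrix.add_kronecker, Matrix.one_kronecker_one, Matrix.mul_add,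
      Matrix.add_mul, Matrix.mul_one, Matrix.trace_add, Complex.add_re] at h0
    rw [← neg_one_smul ℂ, Matrix.smul_kronecker, Matrix.mul_smul, Matrix.smul_mul,
      Matrix.trace_smul] at h0
    simp only [neg_smul, one_smul, Complex.neg_re] at h0
    linarith
  rw [sandwichNorm, specSum_eq_sum_eigenvalues _ hZ.isHermitian]
  refine Real.rpow_le_rpow
    (Finset.sum_nonneg fun i _ => Real.rpow_nonneg (hZ.eigenvalues_nonneg i) _)
    (Finset.sum_le_sum fun i _ => Real.rpow_le_rpow (hZ.eigenvalues_nonneg i)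
      ((eigenvalues_le_trace hZ i).trans htrace) hp) (by positivity)

/-- A bound for `sandwichNorm` on squares of density powers gives one on all positive
semidefinite matrices. -/
lemma sandwichNorm_le_of_density {p r S : ℝ} (hp : p ≠ 0) (hr : 0 < r)
    (T : Matrix (k × l) (k × l) ℂ)
    (hS : ∀ C : Matrix k k ℂ, C.PosSemidef → C.trace = 1 →
      sandwichNorm p T (mrpow C (1 / (2 * r)) * mrpow C (1 / (2 * r))) ≤ S)
    {H : Matrix k k ℂ} (hH : H.PosSemidef) (ha : 0 < specSum (fun x => x ^ r) H) :
    sandwichNorm p T H ≤ specSum (fun x => x ^ r) H ^ (1 / r) * S := by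
  obtain ⟨C, hC, htr, hHC⟩ := exists_density_mrpow_sq hr hH ha
  have hK := Matrix.posSemidef_conjTranspose_mul_self (mrpow C (1 / (2 * r)))
  rw [(isHermitian_mrpow hC.isHermitian _).eq] at hK
  have h := sandwichNorm_smul hp T hK (Real.rpow_nonneg ha.le (1 / r))
  rw [← hHC] at h
  rw [h]
  exact mul_le_mul_of_nonneg_left (hS C hC htr) (Real.rpow_nonneg ha.le _)

end Sandwich

lemma two_mul_ncR_toReal {p q : ℝ≥0∞} (hp : 1 ≤ p) (hpq : p < q) {r : ℝ}
    (hr : 1 / r = 1 / p.toReal - 1 / q.toReal) :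
    0 < r ∧ 2 * ncR p q ≠ ⊤ ∧ (2 * ncR p q).toReal = 2 * r := by
  have hp0 : p ≠ 0 := (zero_lt_one.trans_le hp).ne'
  have hinv : q⁻¹ < p⁻¹ := ENNReal.inv_lt_inv.mpr hpq
  have hptop : p⁻¹ ≠ ⊤ := ENNReal.inv_ne_top.mpr hp0
  have hncR : ncR p q = (p⁻¹ - q⁻¹)⁻¹ := by
    rw [ncR, max_eq_left hinv.le, min_eq_right hinv.le]
  have hsub : p⁻¹ - q⁻¹ ≠ 0 := (tsub_pos_of_lt hinv).ne'
  have htoReal : (p⁻¹ - q⁻¹).toReal = 1 / r := by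
    rw [ENNReal.toReal_sub_of_le hinv.le hptop, hr, ENNReal.toReal_inv, ENNReal.toReal_inv,
      one_div, one_div]
  have hrpos : 0 < 1 / r := by
    rw [← htoReal]
    exact ENNReal.toReal_pos hsub (ENNReal.sub_ne_top hptop)
  refine ⟨one_div_pos.mp hrpos, ?_, ?_⟩
  · rw [hncR]
    exact ENNReal.mul_ne_top ENNReal.ofNat_ne_top (ENNReal.inv_ne_top.mpr hsub)
  · rw [hncR, ENNReal.toReal_mul, ENNReal.toReal_inv, htoReal]
    simp

section Schatten

variable {k : Type*} [Fintype k] [DecidableEq k]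

lemma schattenNorm_two_mul {s : ℝ≥0∞} (hs : s ≠ ⊤) {r : ℝ} (hr : 0 < r)
    (hsr : s.toReal = 2 * r) (A : Matrix k k ℂ) :
    schattenNorm s A = √(specSum (fun x => x ^ r) (Aᴴ * A) ^ (1 / r)) := by
  have h0 := specSum_rpow_nonneg r (Matrix.posSemidef_conjTranspose_mul_self A)
  rw [schattenNorm_eq_specSum hs, hsr, mul_div_cancel_left₀ _ two_ne_zero, Real.sqrt_eq_rpow,
    ← Real.rpow_mul h0]
  congr 1
  field_simp

lemma schattenNorm_mrpow_density {s : ℝ≥0∞} (hs : s ≠ ⊤) {r : ℝ} (hr : 0 < r)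
    (hsr : s.toReal = 2 * r) {C : Matrix k k ℂ} (hC : C.PosSemidef) (htr : C.trace = 1) :
    schattenNorm s (mrpow C (1 / (2 * r))) = 1 := by
  have hh := hC.isHermitian
  have h1 : specSum (fun x => x ^ r) (mrpow C (1 / (2 * r)) * mrpow C (1 / (2 * r))) = 1 := by
    rw [mrpow_eq_cfc hh, ← cfc_mul _ _ C (continuousOn_spectrum _ _) (continuousOn_spectrum _ _),
      specSum_cfc _ _ hh]
    have h := hh.trace_eq_sum_eigenvalues
    rw [htr] at h
    calc _ = ∑ i, hh.eigenvalues i := Finset.sum_congr rfl fun i _ => by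
          rw [← Real.rpow_add_of_nonneg (hC.eigenvalues_nonneg i) (by positivity) (by positivity),
            ← Real.rpow_mul (hC.eigenvalues_nonneg i)]
          field_simp
          norm_num
      _ = 1 := by
          rw [← Complex.ofReal_inj, Complex.ofReal_sum, Complex.ofReal_one]
          exact h.symm
  rw [schattenNorm_two_mul hs hr hsr, (isHermitian_mrpow hh _).eq, h1, Real.one_rpow,
    Real.sqrt_one]

end Schatten

/-- **Reduction of the NC norm (`p < q`) to a supremum over density matrices** for positive
semidefinite `Y`. -/
theorem ncNormSup_eq_sup_density {n m : ℕ} (hn : 0 < n) (hm : 0 < m) (p q : ℝ≥0∞)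
    (hp : 1 ≤ p) (hpq : p < q) (r : ℝ) (hr : 1 / r = 1 / p.toReal - 1 / q.toReal)
    (Y : Matrix (Fin n × Fin m) (Fin n × Fin m) ℂ) (hY : Y.PosSemidef) :
    ncNormSup p q Y = sSup { x : ℝ | ∃ C : Matrix (Fin n) (Fin n) ℂ,
      C.PosSemidef ∧ C.trace = 1 ∧
      x = schattenNorm p
        ((mrpow C (1 / (2 * r)) ⊗ₖ (1 : Matrix (Fin m) (Fin m) ℂ)) * Y *
          (mrpow C (1 / (2 * r)) ⊗ₖ (1 : Matrix (Fin m) (Fin m) ℂ))) } := by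
  obtain ⟨hr0, hR, hRr⟩ := two_mul_ncR_toReal hp hpq hr
  have hp' : p ≠ ⊤ := hpq.ne_top
  have hP : 0 < p.toReal := ENNReal.toReal_pos (zero_lt_one.trans_le hp).ne' hp'
  obtain ⟨T, rfl⟩ := exists_eq_conjTranspose_mul_self hY
  set S := { x : ℝ | ∃ C : Matrix (Fin n) (Fin n) ℂ,
      C.PosSemidef ∧ C.trace = 1 ∧
      x = schattenNorm p
        ((mrpow C (1 / (2 * r)) ⊗ₖ (1 : Matrix (Fin m) (Fin m) ℂ)) * (Tᴴ * T) *
          (mrpow C (1 / (2 * r)) ⊗ₖ (1 : Matrix (Fin m) (Fin m) ℂ))) }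
  have hbdd : BddAbove S := by
    refine ⟨(∑ _i : Fin n × Fin m, (T * Tᴴ).trace.re ^ p.toReal) ^ (1 / p.toReal), ?_⟩
    rintro x ⟨C, hC, htr, rfl⟩
    rw [schattenNorm_sandwich hp' T (isHermitian_mrpow hC.isHermitian _)]
    exact sandwichNorm_mrpow_sq_le hP.le T hC htr (by positivity)
  have hS_nonneg : 0 ≤ sSup S := Real.sSup_nonneg (by
    rintro x ⟨C, -, -, rfl⟩
    exact schattenNorm_nonneg hp' _)
  have hdens : ∀ C : Matrix (Fin n) (Fin n) ℂ, C.PosSemidef → C.trace = 1 →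
      sandwichNorm p.toReal T (mrpow C (1 / (2 * r)) * mrpow C (1 / (2 * r))) ≤ sSup S :=
    fun C hC htr => le_csSup hbdd ⟨C, hC, htr,
      (schattenNorm_sandwich hp' T (isHermitian_mrpow hC.isHermitian _)).symm⟩
  have hratio : ∀ A B : Matrix (Fin n) (Fin n) ℂ,
      schattenNorm p ((A ⊗ₖ (1 : Matrix (Fin m) (Fin m) ℂ)) * (Tᴴ * T) *
        (B ⊗ₖ (1 : Matrix (Fin m) (Fin m) ℂ))) /
        (schattenNorm (2 * ncR p q) A * schattenNorm (2 * ncR p q) B) ≤ sSup S := by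
    intro A B
    rw [schattenNorm_two_mul hR hr0 hRr A, schattenNorm_two_mul hR hr0 hRr B,
      specSum_mul_comm _ Bᴴ B]
    have hA := Matrix.posSemidef_conjTranspose_mul_self A
    have hB := Matrix.posSemidef_self_mul_conjTranspose B
    rcases (specSum_rpow_nonneg r hA).eq_or_lt with ha | ha
    · rw [← ha, Real.zero_rpow (by positivity)]
      simpa using hS_nonneg
    rcases (specSum_rpow_nonneg r hB).eq_or_lt with hb | hb
    · rw [← hb, Real.zero_rpow (by positivity)]
      simpa using hS_nonneg
    have ha' := Real.rpow_pos_of_pos ha (1 / r)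
    have hb' := Real.rpow_pos_of_pos hb (1 / r)
    rw [div_le_iff₀ (mul_pos (Real.sqrt_pos.mpr ha') (Real.sqrt_pos.mpr hb'))]
    calc _ ≤ _ := schattenNorm_mul_mul_le hp hp' T A B
      _ ≤ √(_ * sSup S) * √(_ * sSup S) := mul_le_mul
          (Real.sqrt_le_sqrt (sandwichNorm_le_of_density hP.ne' hr0 T hdens hA ha))
          (Real.sqrt_le_sqrt (sandwichNorm_le_of_density hP.ne' hr0 T hdens hB hb))
          (Real.sqrt_nonneg _) (Real.sqrt_nonneg _)
      _ = _ := by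
          rw [Real.sqrt_mul ha'.le, Real.sqrt_mul hb'.le, mul_mul_mul_comm,
            Real.mul_self_sqrt hS_nonneg, mul_comm]
  refine le_antisymm (Real.iSup_le (fun A => Real.iSup_le (hratio A) hS_nonneg) hS_nonneg)
    (Real.sSup_le ?_ (Real.iSup_nonneg fun A => Real.iSup_nonneg fun B => ?_))
  · rintro x ⟨C, hC, htr, rfl⟩
    have h1 := schattenNorm_mrpow_density hR hr0 hRr hC htr
    set K := mrpow C (1 / (2 * r))
    refine le_trans (le_of_eq ?_) (le_ciSup_of_le (f := fun A : Matrix (Fin n) (Fin n) ℂ =>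
      ⨆ B : Matrix (Fin n) (Fin n) ℂ, schattenNorm p ((A ⊗ₖ (1 : Matrix (Fin m) (Fin m) ℂ)) *
        (Tᴴ * T) * (B ⊗ₖ (1 : Matrix (Fin m) (Fin m) ℂ))) /
          (schattenNorm (2 * ncR p q) A * schattenNorm (2 * ncR p q) B))
      ⟨sSup S, ?_⟩ K (le_ciSup (⟨sSup S, ?_⟩) K))
    · rw [h1, mul_one, div_one]
    · rintro _ ⟨A, rfl⟩
      exact Real.iSup_le (hratio A) hS_nonneg
    · rintro _ ⟨B, rfl⟩
      exact hratio K B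
  · exact div_nonneg (schattenNorm_nonneg hp' _)
      (mul_nonneg (schattenNorm_nonneg hR _) (schattenNorm_nonneg hR _))
end

section
/- Let 0 < t < 1 and define t' by 1/t' = 1/t − 1. Then for all positive reals a_1, …, a_n, (∑_{i=1}^n a_i^t)^{1/t} = inf{ ∑_{i=1}^n a_i b_i : b_1, …, b_n > 0, ∑_{i=1}^n b_i^{−t'} = 1 }. -/
open scoped Kronecker
open Matrix
open scoped ENNReal NNReal ComplexOrder

/-- **Reverse Hölder inequality** for `0 < t < 1`, normalized in the second argument. -/
theorem rpow_sum_rpow_le_sum_mul {ι : Type*} [Fintype ι] {t : ℝ} (ht0 : 0 < t) (ht1 : t < 1)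
    {a b : ι → ℝ} (ha : ∀ i, 0 < a i) (hb : ∀ i, 0 < b i)
    (hsum : ∑ i, b i ^ (-(t / (1 - t))) = 1) :
    (∑ i, a i ^ t) ^ (1 / t) ≤ ∑ i, a i * b i := by
  have h1t : 0 < 1 - t := by linarith
  have hpq : (1 / t).HolderConjugate (1 / (1 - t)) := by
    rw [Real.holderConjugate_iff]
    refine ⟨by rw [lt_div_iff₀ ht0]; linarith, ?_⟩
    simp
  have hab : 0 ≤ ∑ i, a i * b i := Finset.sum_nonneg fun i _ => (mul_pos (ha i) (hb i)).le
  have holder := Real.inner_le_Lp_mul_Lq_of_nonneg Finset.univ hpq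
    (f := fun i => (a i * b i) ^ t) (g := fun i => b i ^ (-t))
    (fun i _ => Real.rpow_nonneg (mul_pos (ha i) (hb i)).le _)
    (fun i _ => Real.rpow_nonneg (hb i).le _)
  have hl : ∀ i, (a i * b i) ^ t * b i ^ (-t) = a i ^ t := fun i => by
    rw [Real.mul_rpow (ha i).le (hb i).le, mul_assoc, ← Real.rpow_add (hb i)]
    simp
  have hf : ∀ i, ((a i * b i) ^ t) ^ (1 / t) = a i * b i := fun i => by
    rw [one_div, Real.rpow_rpow_inv (mul_pos (ha i) (hb i)).le ht0.ne']
  have hg : ∀ i, (b i ^ (-t)) ^ (1 / (1 - t)) = b i ^ (-(t / (1 - t))) := fun i => by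
    rw [← Real.rpow_mul (hb i).le]
    congr 1
    ring
  simp only [hl, hf, hg, hsum, Real.one_rpow, mul_one, one_div_one_div] at holder
  calc (∑ i, a i ^ t) ^ (1 / t) ≤ ((∑ i, a i * b i) ^ t) ^ (1 / t) :=
        Real.rpow_le_rpow (Finset.sum_nonneg fun i _ => Real.rpow_nonneg (ha i).le _) holder
          (one_div_pos.2 ht0).le
    _ = ∑ i, a i * b i := by rw [one_div, Real.rpow_rpow_inv hab ht0.ne']

/-- **Duality formula for the `ℓ^t` "norm" with `0 < t < 1`**:
`(∑ aᵢ^t)^{1/t} = inf { ∑ aᵢ bᵢ : bᵢ > 0, ∑ bᵢ^{-t'} = 1 }`, where `1/t' = 1/t - 1`. -/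
theorem lt_one_duality (t t' : ℝ) (ht0 : 0 < t) (ht1 : t < 1) (ht' : 1 / t' = 1 / t - 1)
    (n : ℕ) (a : Fin n → ℝ) (ha : ∀ i, 0 < a i) :
    (∑ i, a i ^ t) ^ (1 / t) =
      sInf { s : ℝ | ∃ b : Fin n → ℝ, (∀ i, 0 < b i) ∧
        (∑ i, b i ^ (-t') = 1) ∧ s = ∑ i, a i * b i } := by
  have h1t : 0 < 1 - t := by linarith
  have ht'_eq : t' = t / (1 - t) := by
    rw [← one_div_one_div t', ht']
    field_simp
  rcases Nat.eq_zero_or_pos n with rfl | hn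
  · simp [ht0.ne']
  have hS : 0 < ∑ i, a i ^ t :=
    Finset.sum_pos (fun i _ => Real.rpow_pos_of_pos (ha i) t) ⟨⟨0, hn⟩, Finset.mem_univ _⟩
  refine (IsLeast.csInf_eq ⟨?_, ?_⟩).symm
  · refine ⟨fun i => a i ^ (t - 1) * (∑ j, a j ^ t) ^ (1 / t - 1), fun i =>
      mul_pos (Real.rpow_pos_of_pos (ha i) _) (Real.rpow_pos_of_pos hS _), ?_, ?_⟩
    · have h : ∀ i, (a i ^ (t - 1) * (∑ j, a j ^ t) ^ (1 / t - 1)) ^ (-t') =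
          a i ^ t * (∑ j, a j ^ t) ^ (-1 : ℝ) := fun i => by
        rw [Real.mul_rpow (Real.rpow_nonneg (ha i).le _) (Real.rpow_nonneg hS.le _),
          ← Real.rpow_mul (ha i).le, ← Real.rpow_mul hS.le, ht'_eq]
        congr 2 <;> field_simp <;> ring
      simp only [h]
      rw [← Finset.sum_mul, Real.rpow_neg_one, mul_inv_cancel₀ hS.ne']
    · have h : ∀ i, a i * (a i ^ (t - 1) * (∑ j, a j ^ t) ^ (1 / t - 1)) =
          a i ^ t * (∑ j, a j ^ t) ^ (1 / t - 1) := fun i => by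
        rw [← mul_assoc, Real.rpow_sub_one (ha i).ne', mul_div_cancel₀ _ (ha i).ne']
      simp only [h]
      rw [← Finset.sum_mul, Real.rpow_sub_one hS.ne', mul_div_cancel₀ _ hS.ne']
  · rintro s ⟨b, hb, hsum, rfl⟩
    exact rpow_sum_rpow_le_sum_mul ht0 ht1 ha hb (ht'_eq ▸ hsum)
end

section
/- Let 1 ≤ p ≤ 2 and q ≥ 1. For every positive semidefinite Y ∈ M_n ⊗ M_m, ‖Y‖_{CL} ≤ Ψ_{p,q}(Y). -/
open scoped Kronecker
open Matrix
open scoped ENNReal NNReal ComplexOrder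

/-- A matrix power with real exponent agrees with any polynomial interpolating it on the
spectrum. -/
theorem mrpow_eq_aeval {k : Type*} [Fintype k] [DecidableEq k] {A : Matrix k k ℂ}
    (hA : A.IsHermitian) (e : ℝ) (g : Polynomial ℂ)
    (hg : ∀ i, g.eval (hA.eigenvalues i : ℂ) = ((hA.eigenvalues i ^ e : ℝ) : ℂ)) :
    mrpow A e = Polynomial.aeval A g := by
  have hd : Polynomial.aeval (diagonal (RCLike.ofReal ∘ hA.eigenvalues : k → ℂ)) g =
      diagonal (fun i => ((hA.eigenvalues i ^ e : ℝ) : ℂ)) := by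
    have h := Polynomial.aeval_algHom_apply (Matrix.diagonalAlgHom ℂ (n := k) (α := ℂ))
      (RCLike.ofReal ∘ hA.eigenvalues : k → ℂ) g
    simp only [Matrix.diagonalAlgHom_apply] at h
    rw [h]
    congr 1
    funext i
    rw [← hg i]
    simp
  have h := Polynomial.aeval_algHom_apply
    (Unitary.conjStarAlgAut ℂ (Matrix k k ℂ) hA.eigenvectorUnitary).toAlgEquiv.toAlgHom
    (diagonal (RCLike.ofReal ∘ hA.eigenvalues : k → ℂ)) g
  rw [hd] at h
  rw [mrpow, dif_pos hA]
  conv_rhs => rw [hA.spectral_theorem]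
  exact h.symm

theorem mrpow_posSemidef {k : Type*} [Fintype k] [DecidableEq k] {A : Matrix k k ℂ}
    (hA : A.PosSemidef) (e : ℝ) : (mrpow A e).PosSemidef := by
  rw [mrpow, dif_pos hA.isHermitian]
  refine PosSemidef.mul_mul_conjTranspose_same (PosSemidef.diagonal fun i => ?_) _
  simpa using Real.rpow_nonneg (hA.eigenvalues_nonneg i) e

theorem ptrace2_posSemidef_s17 {k l : Type*} [Fintype k] [Fintype l]
    {Y : Matrix (k × l) (k × l) ℂ} (hY : Y.PosSemidef) : (ptrace2 Y).PosSemidef := by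
  have h : ptrace2 Y = ∑ j : l, Y.submatrix (fun i => (i, j)) (fun i => (i, j)) := by
    ext i i'
    simp [ptrace2, Matrix.sum_apply]
  rw [h]
  exact posSemidef_sum _ fun j _ => hY.submatrix _

theorem Psi_nonneg {k l : Type*} [Fintype k] [DecidableEq k] [Fintype l] [DecidableEq l]
    (p q : ℝ) {Y : Matrix (k × l) (k × l) ℂ} (hY : Y.PosSemidef) : 0 ≤ Psi p q Y := by
  refine Real.rpow_nonneg ?_ _
  exact (Complex.le_def.mp
    (mrpow_posSemidef (ptrace2_posSemidef_s17 (mrpow_posSemidef hY p)) (q / p)).trace_nonneg).1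

/-- The embedding `Y ↦ Y ⊗ P` of `M_k ⊗ M_l` into `M_k ⊗ (M_l ⊗ M_o)`. -/
def tensorRight {k l o : Type*} (P : Matrix o o ℂ) :
    Matrix (k × l) (k × l) ℂ →ₗ[ℂ] Matrix (k × (l × o)) (k × (l × o)) ℂ where
  toFun Y := (Y ⊗ₖ P).submatrix (Equiv.prodAssoc k l o).symm (Equiv.prodAssoc k l o).symm
  map_add' Y Z := by rw [add_kronecker]; rfl
  map_smul' c Y := by rw [smul_kronecker]; rfl

section

variable {k l o : Type*} [Fintype l] [Fintype o] {P : Matrix o o ℂ}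

theorem ptrace2_tensorRight (Y : Matrix (k × l) (k × l) ℂ) :
    ptrace2 (tensorRight P Y) = P.trace • ptrace2 Y := by
  ext i i'
  simp [ptrace2, tensorRight, Fintype.sum_prod_type, Matrix.trace, ← Finset.sum_mul,
    mul_comm]

variable [Fintype k]

theorem tensorRight_mul (hP : P * P = P) (Y Z : Matrix (k × l) (k × l) ℂ) :
    tensorRight P (Y * Z) = tensorRight P Y * tensorRight P Z := by
  simp only [tensorRight, LinearMap.coe_mk, AddHom.coe_mk]
  rw [submatrix_mul_equiv, ← mul_kronecker_mul, hP]

theorem tensorRight_posSemidef (hP : P.PosSemidef) {Y : Matrix (k × l) (k × l) ℂ}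
    (hY : Y.PosSemidef) : (tensorRight P Y).PosSemidef :=
  (hY.kronecker hP).submatrix _

variable [DecidableEq k] [DecidableEq l] [DecidableEq o]

theorem aeval_tensorRight (hP : P * P = P) (Y : Matrix (k × l) (k × l) ℂ)
    (g : Polynomial ℂ) :
    Polynomial.aeval (tensorRight P Y) (g * Polynomial.X) =
      tensorRight P (Polynomial.aeval Y (g * Polynomial.X)) := by
  induction g using Polynomial.induction_on' with
  | add f g hf hg => rw [add_mul, map_add, map_add, map_add, hf, hg]
  | monomial n a =>
    have hpow : ∀ n : ℕ, tensorRight P Y ^ (n + 1) = tensorRight P (Y ^ (n + 1)) := by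
      intro n
      induction n with
      | zero => simp
      | succ n ih => rw [pow_succ, ih, ← tensorRight_mul hP, ← pow_succ]
    rw [Polynomial.monomial_mul_X, Polynomial.aeval_monomial, Polynomial.aeval_monomial,
      ← Algebra.smul_def, ← Algebra.smul_def, map_smul, hpow]

theorem mrpow_tensorRight (hP : P * P = P) (hP' : P.IsHermitian)
    {Y : Matrix (k × l) (k × l) ℂ} (hY : Y.IsHermitian) {e : ℝ} (he : e ≠ 0) :
    mrpow (tensorRight P Y) e = tensorRight P (mrpow Y e) := by
  have hT : (tensorRight P Y).IsHermitian := by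
    have : (Y ⊗ₖ P).IsHermitian := by
      rw [IsHermitian, conjTranspose_kronecker, hY.eq, hP'.eq]
    exact this.submatrix _
  set S : Finset ℂ := insert 0 (Finset.univ.image (fun i => (hY.eigenvalues i : ℂ)) ∪
    Finset.univ.image (fun i => (hT.eigenvalues i : ℂ))) with hS
  set g := Lagrange.interpolate S id (fun z => ((z.re ^ e : ℝ) : ℂ)) with hg
  have hev : ∀ z ∈ S, g.eval z = ((z.re ^ e : ℝ) : ℂ) := fun z hz =>
    Lagrange.eval_interpolate_at_node _ Function.injective_id.injOn hz
  have hg0 : g.eval 0 = 0 := by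
    rw [hev 0 (by simp [hS])]
    simp [Real.zero_rpow he]
  obtain ⟨h, hh⟩ : Polynomial.X ∣ g := by
    rwa [Polynomial.X_dvd_iff, Polynomial.coeff_zero_eq_eval_zero]
  rw [mrpow_eq_aeval hY e g fun i => hev _ (by simp [hS]),
    mrpow_eq_aeval hT e g fun i => hev _ (by simp [hS]), hh,
    mul_comm, aeval_tensorRight hP]

theorem Psi_tensorRight (hP : P * P = P) (hP' : P.IsHermitian) (htr : P.trace = 1)
    {Y : Matrix (k × l) (k × l) ℂ} (hY : Y.IsHermitian) {p : ℝ} (hp : p ≠ 0) (q : ℝ) :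
    Psi p q (tensorRight P Y) = Psi p q Y := by
  rw [Psi, Psi, mrpow_tensorRight hP hP' hY hp, ptrace2_tensorRight, htr, one_smul]

end

/-- The rank-one projection of `M_2` onto the span of `(1, s)`, for a sign `s = ±1`. -/
noncomputable def signProj (s : ℂ) : Matrix (Fin 2) (Fin 2) ℂ := !![1 / 2, s / 2; s / 2, 1 / 2]

theorem signProj_mul_self {s : ℂ} (hs : s * s = 1) : signProj s * signProj s = signProj s := by
  ext i j
  fin_cases i <;> fin_cases j <;> simp [signProj, Matrix.mul_apply] <;> grind

theorem signProj_isHermitian {s : ℂ} (hs : star s = s) : (signProj s).IsHermitian := by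
  ext i j
  have hs' : (starRingEnd ℂ) s = s := hs
  fin_cases i <;> fin_cases j <;> simp [signProj, hs']

theorem signProj_posSemidef {s : ℂ} (hs : s * s = 1) (hs' : star s = s) :
    (signProj s).PosSemidef := by
  have h := posSemidef_conjTranspose_mul_self (signProj s)
  rwa [(signProj_isHermitian hs').eq, signProj_mul_self hs] at h

theorem trace_signProj (s : ℂ) : (signProj s).trace = 1 := by
  simp [signProj, Matrix.trace_fin_two]
  norm_num

theorem clBlock_add_tensorRight {k l : Type*} {Y : Matrix (k × l) (k × l) ℂ}
    (hY : Y.IsHermitian) :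
    clBlock Y + tensorRight (signProj (-1)) Y = tensorRight (signProj 1) Y := by
  ext ⟨i, j, a⟩ ⟨i', j', b⟩
  have h : (starRingEnd ℂ) (Y (i', j') (i, j)) = Y (i, j) (i', j') := hY.apply _ _
  fin_cases a <;> fin_cases b <;> simp [clBlock, tensorRight, signProj, h] <;> ring

/-- **The Carlen–Lieb norm is bounded above by `Ψ_{p,q}` on positive semidefinite matrices.** -/
theorem clNorm_le_psi {n m : ℕ} (hn : 0 < n) (hm : 0 < m) (p q : ℝ)
    (hp1 : 1 ≤ p) (hp2 : p ≤ 2) (hq : 1 ≤ q)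
    (Y : Matrix (Fin n × Fin m) (Fin n × Fin m) ℂ) (hY : Y.PosSemidef) :
    clNorm p q Y ≤ Psi p q Y := by
  have h1 : (signProj 1).PosSemidef := signProj_posSemidef (by simp) (by simp)
  have h2 : (signProj (-1)).PosSemidef := signProj_posSemidef (by simp) (by simp)
  have hp : p ≠ 0 := by positivity
  have hle : tripleNorm p q (clBlock Y) ≤ Psi p q Y + Psi p q Y := by
    refine csInf_le ⟨0, ?_⟩ ⟨tensorRight (signProj (-1)) Y, tensorRight (signProj 1) Y,
      tensorRight_posSemidef h2 hY, tensorRight_posSemidef h1 hY,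
      clBlock_add_tensorRight hY.isHermitian, ?_⟩
    · rintro _ ⟨A, B, hA, hB, -, rfl⟩
      exact add_nonneg (Psi_nonneg p q hA) (Psi_nonneg p q hB)
    · rw [Psi_tensorRight (signProj_mul_self (by simp)) h2.isHermitian (trace_signProj _)
          hY.isHermitian hp,
        Psi_tensorRight (signProj_mul_self (by simp)) h1.isHermitian (trace_signProj _)
          hY.isHermitian hp]
  rw [clNorm]
  linarith
end

section
/- [Strict monotonicity of Schatten norms on the positive cone] Let 1 ≤ t < ∞ and let C, D ∈ M_n be positive semidefinite with D ≠ 0. Then ‖C‖_t < ‖C + D‖_t. -/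
open scoped Kronecker
open Matrix
open scoped ENNReal NNReal ComplexOrder

namespace Matrix

variable {k : Type*} [Fintype k] [DecidableEq k]

theorem IsHermitian.sum_eigenvalues_conjTranspose_mul_self {A : Matrix k k ℂ}
    (hA : A.IsHermitian) (hB : (Aᴴ * A).IsHermitian) (f : ℝ → ℝ) :
    ∑ i, f (hB.eigenvalues i) = ∑ i, f (hA.eigenvalues i ^ 2) := by
  have hsq : Aᴴ * A = cfc (fun x : ℝ => x ^ 2) A := by
    rw [hA.eq, ← sq]
    exact (cfc_pow_id (R := ℝ) A 2 (ha := hA)).symm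
  have hroots : Multiset.map (fun i => ((hB.eigenvalues i : ℝ) : ℂ)) Finset.univ.val =
      Multiset.map (fun i => ((hA.eigenvalues i ^ 2 : ℝ) : ℂ)) Finset.univ.val := by
    have h := congrArg Polynomial.roots
      ((congrArg charpoly hsq).trans (hA.charpoly_cfc_eq fun x => x ^ 2))
    rw [hB.roots_charpoly_eq_eigenvalues, Polynomial.roots_prod _ _
      (Finset.prod_ne_zero_iff.mpr fun i _ => Polynomial.X_sub_C_ne_zero _)] at h
    simpa only [Polynomial.roots_X_sub_C, Multiset.bind_singleton, Function.comp_def] using! h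
  have h := congrArg (fun s : Multiset ℂ => (s.map fun z => f z.re).sum) hroots
  simpa only [Multiset.map_map, Function.comp_def, Complex.ofReal_re] using! h

theorem sum_normSq_col_of_mem_unitaryGroup {W : Matrix k k ℂ} (hW : W ∈ unitaryGroup k ℂ)
    (i : k) : ∑ j, Complex.normSq (W j i) = 1 := by
  have h := congrFun (congrFun (mem_unitaryGroup_iff'.mp hW) i) i
  rw [star_eq_conjTranspose, mul_apply, one_apply_eq] at h
  have h' : ((∑ j, Complex.normSq (W j i) : ℝ) : ℂ) = 1 := by
    rw [← h]
    push_cast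
    exact Finset.sum_congr rfl fun j _ => by
      rw [conjTranspose_apply, Complex.normSq_eq_conj_mul_self]; rfl
  exact_mod_cast h'

theorem sum_normSq_row_of_mem_unitaryGroup {W : Matrix k k ℂ} (hW : W ∈ unitaryGroup k ℂ)
    (j : k) : ∑ i, Complex.normSq (W j i) = 1 := by
  simpa [star_apply, Complex.normSq_conj] using
    sum_normSq_col_of_mem_unitaryGroup (Unitary.star_mem hW) j

theorem IsHermitian.exists_unitary_conj_diag {B : Matrix k k ℂ} (hB : B.IsHermitian)
    {U : Matrix k k ℂ} (hU : U ∈ unitaryGroup k ℂ) :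
    ∃ W ∈ unitaryGroup k ℂ, ∀ i, ((Uᴴ * B * U) i i).re =
      ∑ j, Complex.normSq (W j i) * hB.eigenvalues j := by
  refine ⟨star (hB.eigenvectorUnitary : Matrix k k ℂ) * U,
    mul_mem (Unitary.star_mem hB.eigenvectorUnitary.2) hU, fun i => ?_⟩
  set W := star (hB.eigenvectorUnitary : Matrix k k ℂ) * U with hW
  have h : Uᴴ * B * U = Wᴴ * diagonal (fun j => (hB.eigenvalues j : ℂ)) * W := by
    conv_lhs => rw [hB.spectral_theorem, Unitary.conjStarAlgAut_apply]
    simp only [hW, star_eq_conjTranspose, conjTranspose_mul, conjTranspose_conjTranspose,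
      Matrix.mul_assoc]
    rfl
  rw [h, mul_apply, Complex.re_sum]
  refine Finset.sum_congr rfl fun j _ => ?_
  rw [mul_diagonal, conjTranspose_apply, Complex.star_def, mul_right_comm,
    ← Complex.normSq_eq_conj_mul_self, ← Complex.ofReal_mul, Complex.ofReal_re]

/-- Peierls' inequality for the power functions. -/
theorem PosSemidef.sum_rpow_diag_le {B : Matrix k k ℂ} (hB : B.PosSemidef)
    {U : Matrix k k ℂ} (hU : U ∈ unitaryGroup k ℂ) {t : ℝ} (ht : 1 ≤ t) :
    ∑ i, ((Uᴴ * B * U) i i).re ^ t ≤ ∑ j, hB.isHermitian.eigenvalues j ^ t := by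
  obtain ⟨W, hW, hdiag⟩ := hB.isHermitian.exists_unitary_conj_diag hU
  calc ∑ i, ((Uᴴ * B * U) i i).re ^ t
      ≤ ∑ i, ∑ j, Complex.normSq (W j i) * hB.isHermitian.eigenvalues j ^ t := by
        refine Finset.sum_le_sum fun i _ => ?_
        rw [hdiag]
        exact Real.rpow_arith_mean_le_arith_mean_rpow _ _ _ (fun j _ => Complex.normSq_nonneg _)
          (sum_normSq_col_of_mem_unitaryGroup hW i) (fun j _ => hB.eigenvalues_nonneg j) ht
    _ = ∑ j, hB.isHermitian.eigenvalues j ^ t := by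
        rw [Finset.sum_comm]
        refine Finset.sum_congr rfl fun j _ => ?_
        rw [← Finset.sum_mul, sum_normSq_row_of_mem_unitaryGroup hW, one_mul]

theorem IsHermitian.diag_conj_eigenvectorUnitary {A : Matrix k k ℂ} (hA : A.IsHermitian)
    (i : k) :
    (((hA.eigenvectorUnitary : Matrix k k ℂ)ᴴ * A * hA.eigenvectorUnitary) i i).re =
      hA.eigenvalues i := by
  have h := hA.conjStarAlgAut_star_eigenvectorUnitary
  rw [Unitary.conjStarAlgAut_star_apply, star_eq_conjTranspose] at h
  rw [h]
  simp

theorem PosSemidef.sum_eigenvalues_rpow_lt {C D : Matrix k k ℂ} (hC : C.PosSemidef)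
    (hD : D.PosSemidef) (hD0 : D ≠ 0) {t : ℝ} (ht : 1 ≤ t) :
    ∑ i, hC.isHermitian.eigenvalues i ^ t <
      ∑ i, (hC.add hD).isHermitian.eigenvalues i ^ t := by
  set U : Matrix k k ℂ := (hC.isHermitian.eigenvectorUnitary : Matrix k k ℂ)
  have hU : U ∈ unitaryGroup k ℂ := hC.isHermitian.eigenvectorUnitary.2
  have hE : (Uᴴ * D * U).PosSemidef := hD.conjTranspose_mul_mul_same U
  have hdiag (i : k) : ((Uᴴ * (C + D) * U) i i).re =
      hC.isHermitian.eigenvalues i + ((Uᴴ * D * U) i i).re := by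
    rw [Matrix.mul_add, Matrix.add_mul, add_apply, Complex.add_re,
      hC.isHermitian.diag_conj_eigenvectorUnitary]
  have hnonneg (i : k) : 0 ≤ (Uᴴ * D * U) i i := hE.diag_nonneg
  refine lt_of_lt_of_le ?_ ((hC.add hD).sum_rpow_diag_le hU ht)
  have hE0 : (Uᴴ * D * U).trace ≠ 0 := by
    rw [trace_mul_cycle, ← star_eq_conjTranspose, mem_unitaryGroup_iff.mp hU, one_mul]
    exact hD.trace_eq_zero_iff.not.mpr hD0
  obtain ⟨i, -, hi⟩ := Finset.exists_ne_zero_of_sum_ne_zero hE0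
  refine Finset.sum_lt_sum (fun j _ => ?_) ⟨i, Finset.mem_univ i, ?_⟩
  · rw [hdiag]
    have := (Complex.nonneg_iff.mp (hnonneg j)).1
    exact Real.rpow_le_rpow (hC.eigenvalues_nonneg j) (by linarith) (by linarith)
  · rw [hdiag]
    have := (Complex.pos_iff.mp (lt_of_le_of_ne (hnonneg i) (Ne.symm hi))).1
    exact Real.rpow_lt_rpow (hC.eigenvalues_nonneg i) (by linarith) (by linarith)

end Matrix

theorem schattenNorm_ofReal_of_posSemidef {k : Type*} [Fintype k] [DecidableEq k]
    {A : Matrix k k ℂ} (hA : A.PosSemidef) {t : ℝ} (ht : 0 ≤ t) :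
    schattenNorm (ENNReal.ofReal t) A =
      (∑ i, hA.isHermitian.eigenvalues i ^ t) ^ (1 / t) := by
  rw [schattenNorm, if_neg ENNReal.ofReal_ne_top, ENNReal.toReal_ofReal ht,
    hA.isHermitian.sum_eigenvalues_conjTranspose_mul_self _ fun x => x ^ (t / 2)]
  congr 1
  refine Finset.sum_congr rfl fun i _ => ?_
  rw [← Real.rpow_natCast, ← Real.rpow_mul (hA.eigenvalues_nonneg i)]
  congr 1
  push_cast
  ring

/-- **Strict monotonicity of the Schatten norms on the positive cone**:
if `C, D ≥ 0` and `D ≠ 0` then `‖C‖_t < ‖C + D‖_t` for `1 ≤ t < ∞`. -/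
theorem schattenNorm_strict_mono {n : ℕ} (t : ℝ) (ht : 1 ≤ t)
    (C D : Matrix (Fin n) (Fin n) ℂ) (hC : C.PosSemidef) (hD : D.PosSemidef) (hD0 : D ≠ 0) :
    schattenNorm (ENNReal.ofReal t) C < schattenNorm (ENNReal.ofReal t) (C + D) := by
  have ht0 : 0 < t := by linarith
  rw [schattenNorm_ofReal_of_posSemidef hC ht0.le,
    schattenNorm_ofReal_of_posSemidef (hC.add hD) ht0.le]
  exact Real.rpow_lt_rpow
    (Finset.sum_nonneg fun i _ => Real.rpow_nonneg (hC.eigenvalues_nonneg i) t)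
    (hC.sum_eigenvalues_rpow_lt hD hD0 ht) (by positivity)
end
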